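/- Let ℓ be a prime with ℓ ≡ 3 (mod 8). Then q₃(ℓ) = R − N, where R is the number of integers x with 1 ≤ x ≤ (ℓ−1)/2 that are quadratic residues modulo ℓ, and N is the number of integers x with 1 ≤ x ≤ (ℓ−1)/2 that are quadratic non-residues modulo ℓ. -/

import Mathlib

/-- `q₃(n)`: the number of ordered triples `(a, b, c)` of positive odd integers
with `a² + b² + c² = n`. -/
noncomputable def q3 (n : ℕ) : ℕ :=
  Nat.card {t : ℤ × ℤ × ℤ // 0 < t.1 ∧ Odd t.1 ∧ 0 < t.2.1 ∧ Odd t.2.1 ∧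
    0 < t.2.2 ∧ Odd t.2.2 ∧ t.1 ^ 2 + t.2.1 ^ 2 + t.2.2 ^ 2 = (n : ℤ)}

theorem Set.ncard_eq_of_inverse {α β : Type*} {A : Set α} {B : Set β} (f : α → β) (g : β → α)
    (hf : ∀ x ∈ A, f x ∈ B ∧ g (f x) = x) (hg : ∀ y ∈ B, g y ∈ A ∧ f (g y) = y) :
    A.ncard = B.ncard :=
  Nat.card_congr
    { toFun := fun x => ⟨f x, (hf x x.2).1⟩
      invFun := fun y => ⟨g y, (hg y y.2).1⟩
      left_inv := fun x => Subtype.ext (hf x x.2).2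
      right_inv := fun y => Subtype.ext (hg y y.2).2 }

theorem Set.Finite.ncard_eq_add {α : Type*} {A : Set α} (hA : A.Finite) (p : α → Prop) :
    A.ncard = {x ∈ A | p x}.ncard + {x ∈ A | ¬ p x}.ncard := by
  classical
  have hdisj : Disjoint {x ∈ A | p x} {x ∈ A | ¬ p x} := by
    rw [Set.disjoint_left]
    rintro x ⟨_, h⟩ ⟨_, h'⟩
    exact h' h
  rw [← Set.ncard_union_eq hdisj (hA.subset fun x hx => hx.1) (hA.subset fun x hx => hx.1)]
  congr 1
  ext x
  simp only [Set.mem_union, Set.mem_ofPred_eq]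
  tauto

/-- The pairs `(x, c)` with `c` odd and positive and `x ∈ A (M - c²)`. -/
def addOddSquare {α : Type*} (A : ℤ → Set α) (M : ℤ) : Set (α × ℤ) :=
  {p | 0 < p.2 ∧ p.2 % 2 = 1 ∧ p.1 ∈ A (M - p.2 ^ 2)}

section addOddSquare

variable {α : Type*} {A : ℤ → Set α}

theorem lt_of_mem_addOddSquare (hA₀ : ∀ N ≤ 0, A N = ∅) {M : ℤ} {p : α × ℤ}
    (hp : p ∈ addOddSquare A M) : p.2 ^ 2 < M := by
  obtain ⟨_, _, h⟩ := hp
  by_contra hle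
  rw [hA₀ _ (by linarith)] at h
  exact h

theorem addOddSquare_eq_empty (hA₀ : ∀ N ≤ 0, A N = ∅) (M : ℤ) (hM : M ≤ 0) :
    addOddSquare A M = ∅ := by
  ext p
  simp only [Set.mem_empty_iff_false, iff_false]
  intro hp
  nlinarith [lt_of_mem_addOddSquare hA₀ hp]

theorem finite_addOddSquare (hA : ∀ N, (A N).Finite) (hA₀ : ∀ N ≤ 0, A N = ∅) (M : ℤ) :
    (addOddSquare A M).Finite := by
  refine Set.Finite.subset (Set.Finite.biUnion (Set.finite_Icc (1 : ℤ) M)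
    fun c _ => ((hA (M - c ^ 2)).prod (Set.finite_singleton c))) ?_
  intro p hp
  have := lt_of_mem_addOddSquare hA₀ hp
  obtain ⟨h1, h2, h3⟩ := hp
  simp only [Set.mem_iUnion, Set.mem_Icc, Set.mem_prod, Set.mem_singleton_iff]
  exact ⟨p.2, ⟨by omega, by nlinarith⟩, h3, rfl⟩

theorem sum_addOddSquare (hA : ∀ N, (A N).Finite) (hA₀ : ∀ N ≤ 0, A N = ∅) (M : ℕ)
    (w : α → ℤ → ℤ) :
    ∑ p ∈ (finite_addOddSquare hA hA₀ M).toFinset, w p.1 p.2 =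
      ∑ j ∈ Finset.range M, ∑ x ∈ (hA (M - (2 * j + 1) ^ 2)).toFinset, w x (2 * j + 1) := by
  rw [Finset.sum_sigma']
  refine Finset.sum_bij' (fun p _ => ⟨(p.2 / 2).toNat, p.1⟩) (fun q _ => (q.2, 2 * (q.1 : ℤ) + 1))
    ?_ ?_ ?_ ?_ ?_
  · rintro ⟨x, c⟩ hp
    rw [Set.Finite.mem_toFinset] at hp
    have := lt_of_mem_addOddSquare hA₀ hp
    obtain ⟨h1, h2, h3⟩ := hp
    dsimp only at *
    have hc : 2 * ((c / 2).toNat : ℤ) + 1 = c := by omega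
    simp only [Finset.mem_sigma, Finset.mem_range, Set.Finite.mem_toFinset, hc]
    refine ⟨?_, h3⟩
    have : c < M := by nlinarith
    omega
  · rintro ⟨j, x⟩ hq
    simp only [Finset.mem_sigma, Finset.mem_range, Set.Finite.mem_toFinset] at hq ⊢
    exact ⟨by dsimp only; omega, by dsimp only; omega, hq.2⟩
  · rintro ⟨x, c⟩ hp
    rw [Set.Finite.mem_toFinset] at hp
    obtain ⟨h1, h2, h3⟩ := hp
    dsimp only at *
    congr 1
    omega
  · rintro ⟨j, x⟩ hq
    have : ((2 * (j : ℤ) + 1) / 2).toNat = j := by omega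
    simp [this]
  · rintro ⟨x, c⟩ hp
    rw [Set.Finite.mem_toFinset] at hp
    obtain ⟨h1, h2, h3⟩ := hp
    dsimp only at *
    congr 1
    omega

theorem ncard_addOddSquare (hA : ∀ N, (A N).Finite) (hA₀ : ∀ N ≤ 0, A N = ∅) (M : ℕ) :
    (addOddSquare A M).ncard =
      ∑ j ∈ Finset.range M, (A (M - (2 * j + 1) ^ 2)).ncard := by
  have h := sum_addOddSquare hA hA₀ M (fun _ _ => 1)
  simp only [Finset.sum_const, nsmul_eq_mul, mul_one] at h
  rw [Set.ncard_eq_toFinset_card _ (finite_addOddSquare hA hA₀ M)]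
  have h2 : ∀ N, (A N).ncard = (hA N).toFinset.card := fun N => Set.ncard_eq_toFinset_card _ (hA N)
  simp only [h2]
  exact_mod_cast h

end addOddSquare

/-- Factorizations `4 * a * k = N` into odd positive `a` and `k`. -/
def oddFactorizations (N : ℤ) : Set (ℤ × ℤ) :=
  {p | 0 < p.1 ∧ p.1 % 2 = 1 ∧ 0 < p.2 ∧ p.2 % 2 = 1 ∧ 4 * p.1 * p.2 = N}

theorem oddFactorizations_eq_empty (N : ℤ) (hN : N ≤ 0) : oddFactorizations N = ∅ := by
  ext ⟨a, k⟩
  simp only [Set.mem_empty_iff_false, iff_false]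
  rintro ⟨h1, _, h2, _, h3⟩
  dsimp only at *
  nlinarith [mul_pos h1 h2]

theorem finite_oddFactorizations (N : ℤ) : (oddFactorizations N).Finite := by
  refine ((Set.finite_Icc (1 : ℤ) N).prod (Set.finite_Icc (1 : ℤ) N)).subset ?_
  rintro ⟨a, k⟩ ⟨h1, _, h2, _, h3⟩
  dsimp only at *
  simp only [Set.mem_prod, Set.mem_Icc]
  refine ⟨⟨?_, ?_⟩, ?_, ?_⟩ <;> nlinarith [mul_pos h1 h2]

/-- The sum of `k` over the factorizations `4 * a * k = N` into odd positive `a` and `k`. -/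
noncomputable def oddSigma (N : ℤ) : ℤ :=
  ∑ p ∈ (finite_oddFactorizations N).toFinset, p.2

theorem finite_indefinite (M : ℤ) :
    {p : ℤ × ℤ × ℤ | 0 < p.1 ∧ p.1 % 2 = 1 ∧ p.2.1 % 2 = 1 ∧ 0 < p.2.2 ∧ p.2.2 % 2 = 1 ∧
      p.2.1 ^ 2 + 4 * p.1 * p.2.2 = M}.Finite := by
  refine ((Set.finite_Icc (1 : ℤ) M).prod
    ((Set.finite_Icc (-M) M).prod (Set.finite_Icc (1 : ℤ) M))).subset ?_
  rintro ⟨a, c, k⟩ ⟨h1, _, _, h2, _, h3⟩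
  dsimp only at *
  simp only [Set.mem_prod, Set.mem_Icc]
  refine ⟨⟨?_, ?_⟩, ⟨?_, ?_⟩, ?_, ?_⟩ <;> nlinarith [mul_pos h1 h2, sq_nonneg c]

theorem sum_indefinite_eq_zero (M : ℤ) :
    ∑ p ∈ (finite_indefinite M).toFinset, (p.1 * p.2.2 - p.2.1 ^ 2) * (p.1 + p.2.2) = 0 := by
  set U := (finite_indefinite M).toFinset with hU
  have memU : ∀ a c k : ℤ, (a, c, k) ∈ U ↔ 0 < a ∧ a % 2 = 1 ∧ c % 2 = 1 ∧ 0 < k ∧ k % 2 = 1 ∧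
      c ^ 2 + 4 * a * k = M := fun a c k => by simp [hU]
  set V := U.filter (fun p => 0 < p.2.2 + p.2.1 - p.1) with hV
  -- the complement of `V` is exchanged with `V`
  have split : ∀ f : ℤ × ℤ × ℤ → ℤ, (∀ a c k, f (k, -c, a) = f (a, c, k)) →
      ∑ p ∈ U, f p = 2 * ∑ p ∈ V, f p := by
    intro f hf
    rw [← Finset.sum_filter_add_sum_filter_not U (fun p => 0 < p.2.2 + p.2.1 - p.1), two_mul]
    congr 1
    refine Finset.sum_bij' (fun p _ => (p.2.2, -p.2.1, p.1)) (fun p _ => (p.2.2, -p.2.1, p.1))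
      ?_ ?_ ?_ ?_ ?_
    · rintro ⟨a, c, k⟩ h
      simp only [hV, Finset.mem_filter, memU] at h ⊢
      obtain ⟨⟨h1, h2, h3, h4, h5, h6⟩, h7⟩ := h
      exact ⟨⟨h4, h5, by omega, h1, h2, by linarith [neg_sq c]⟩, by omega⟩
    · rintro ⟨a, c, k⟩ h
      simp only [hV, Finset.mem_filter, memU] at h ⊢
      obtain ⟨⟨h1, h2, h3, h4, h5, h6⟩, h7⟩ := h
      exact ⟨⟨h4, h5, by omega, h1, h2, by linarith [neg_sq c]⟩, by omega⟩
    · rintro ⟨a, c, k⟩ _; simp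
    · rintro ⟨a, c, k⟩ _; simp
    · rintro ⟨a, c, k⟩ _; exact (hf a c k).symm
  have invol : ∀ f : ℤ × ℤ × ℤ → ℤ,
      ∑ p ∈ V, f p = ∑ p ∈ V, f (p.1, 2 * p.1 - p.2.1, p.2.2 + p.2.1 - p.1) := by
    intro f
    refine Finset.sum_bij' (fun p _ => (p.1, 2 * p.1 - p.2.1, p.2.2 + p.2.1 - p.1))
      (fun p _ => (p.1, 2 * p.1 - p.2.1, p.2.2 + p.2.1 - p.1)) ?_ ?_ ?_ ?_ ?_
    · rintro ⟨a, c, k⟩ h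
      simp only [hV, Finset.mem_filter, memU] at h ⊢
      obtain ⟨⟨h1, h2, h3, h4, h5, h6⟩, h7⟩ := h
      exact ⟨⟨h1, h2, by omega, h7, by omega, by linear_combination h6⟩, by omega⟩
    · rintro ⟨a, c, k⟩ h
      simp only [hV, Finset.mem_filter, memU] at h ⊢
      obtain ⟨⟨h1, h2, h3, h4, h5, h6⟩, h7⟩ := h
      exact ⟨⟨h1, h2, by omega, h7, by omega, by linear_combination h6⟩, by omega⟩
    all_goals
      rintro ⟨a, c, k⟩ _
      have : k + c - a + (2 * a - c) - a = k := by ring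
      simp [this]
  have odd : ∑ p ∈ U, p.2.1 * (p.1 ^ 2 - p.2.2 ^ 2) = 0 := by
    have : ∑ p ∈ U, p.2.1 * (p.1 ^ 2 - p.2.2 ^ 2) =
        ∑ p ∈ U, -(p.2.1 * (p.1 ^ 2 - p.2.2 ^ 2)) := by
      refine Finset.sum_bij' (fun p _ => (p.1, -p.2.1, p.2.2)) (fun p _ => (p.1, -p.2.1, p.2.2))
        ?_ ?_ ?_ ?_ ?_
      · rintro ⟨a, c, k⟩ h
        simp only [memU] at h ⊢
        obtain ⟨h1, h2, h3, h4, h5, h6⟩ := h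
        exact ⟨h1, h2, by omega, h4, h5, by linarith [neg_sq c]⟩
      · rintro ⟨a, c, k⟩ h
        simp only [memU] at h ⊢
        obtain ⟨h1, h2, h3, h4, h5, h6⟩ := h
        exact ⟨h1, h2, by omega, h4, h5, by linarith [neg_sq c]⟩
      · rintro ⟨a, c, k⟩ _; simp
      · rintro ⟨a, c, k⟩ _; simp
      · rintro ⟨a, c, k⟩ _; simp
    rw [Finset.sum_neg_distrib] at this
    linarith
  rw [split (fun p => p.2.1 * (p.1 ^ 2 - p.2.2 ^ 2)) (fun a c k => by ring)] at odd
  rw [split (fun p => (p.1 * p.2.2 - p.2.1 ^ 2) * (p.1 + p.2.2)) (fun a c k => by ring)]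
  have e1 := invol (fun p => p.2.1 * (p.1 ^ 2 - p.2.2 ^ 2))
  have e2 := invol (fun p => (p.1 * p.2.2 - p.2.1 ^ 2) * (p.1 + p.2.2))
  have e3 : ∑ p ∈ V, ((p.1 * p.2.2 - p.2.1 ^ 2) * (p.1 + p.2.2)) +
      ∑ p ∈ V, (p.1 * (p.2.2 + p.2.1 - p.1) - (2 * p.1 - p.2.1) ^ 2) *
        (p.1 + (p.2.2 + p.2.1 - p.1)) +
      (∑ p ∈ V, p.2.1 * (p.1 ^ 2 - p.2.2 ^ 2) + ∑ p ∈ V,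
        (2 * p.1 - p.2.1) * (p.1 ^ 2 - (p.2.2 + p.2.1 - p.1) ^ 2)) = 0 := by
    simp only [← Finset.sum_add_distrib]
    exact Finset.sum_eq_zero fun p _ => by ring
  dsimp only at e1 e2
  linarith

theorem sum_mul_oddSigma_eq_zero (M : ℕ) :
    ∑ j ∈ Finset.range M, ((M : ℤ) - 5 * (2 * j + 1) ^ 2) * oddSigma (M - (2 * j + 1) ^ 2) = 0 := by
  have key := sum_addOddSquare finite_oddFactorizations oddFactorizations_eq_empty M
    (fun x c => (M - 5 * c ^ 2) * x.2)
  simp only [← Finset.mul_sum] at key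
  change _ = ∑ j ∈ Finset.range M, ((M : ℤ) - 5 * (2 * j + 1) ^ 2) *
    oddSigma (M - (2 * j + 1) ^ 2) at key
  rw [← key]
  set S := (finite_addOddSquare finite_oddFactorizations oddFactorizations_eq_empty M).toFinset
    with hS
  have memS : ∀ a k c : ℤ, ((a, k), c) ∈ S ↔ (0 < c ∧ c % 2 = 1) ∧ 0 < a ∧ a % 2 = 1 ∧
      0 < k ∧ k % 2 = 1 ∧ 4 * a * k = M - c ^ 2 := fun a c k => by
    simp [hS, addOddSquare, oddFactorizations, and_assoc]
  have swap : ∑ p ∈ S, ((M : ℤ) - 5 * p.2 ^ 2) * p.1.2 = ∑ p ∈ S, (M - 5 * p.2 ^ 2) * p.1.1 := by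
    refine Finset.sum_bij' (fun p _ => ((p.1.2, p.1.1), p.2)) (fun p _ => ((p.1.2, p.1.1), p.2))
      ?_ ?_ ?_ ?_ ?_
    · rintro ⟨⟨a, k⟩, c⟩ h
      simp only [memS] at h ⊢
      obtain ⟨h0, h1, h2, h3, h4, h5⟩ := h
      exact ⟨h0, h3, h4, h1, h2, by linarith⟩
    · rintro ⟨⟨a, k⟩, c⟩ h
      simp only [memS] at h ⊢
      obtain ⟨h0, h1, h2, h3, h4, h5⟩ := h
      exact ⟨h0, h3, h4, h1, h2, by linarith⟩
    all_goals rintro ⟨⟨a, k⟩, c⟩ _; rfl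
  have half : ∀ s : Finset (ℤ × ℤ × ℤ), (∀ a c k, (a, c, k) ∈ s ↔ c ≠ 0 ∧ ((a, k), |c|) ∈ S) →
      ∑ p ∈ s, (p.1 * p.2.2 - p.2.1 ^ 2) * (p.1 + p.2.2) =
      2 * ∑ p ∈ S, (p.1.1 * p.1.2 - p.2 ^ 2) * (p.1.1 + p.1.2) := by
    intro s hs
    rw [← Finset.sum_filter_add_sum_filter_not s (fun p => 0 < p.2.1), two_mul]
    congr 1
    · refine Finset.sum_bij' (fun p _ => ((p.1, p.2.2), p.2.1))
        (fun p _ => (p.1.1, p.2, p.1.2)) ?_ ?_ ?_ ?_ ?_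
      · rintro ⟨a, c, k⟩ h
        simp only [Finset.mem_filter, hs] at h
        simpa [abs_of_pos h.2] using h.1.2
      · rintro ⟨⟨a, k⟩, c⟩ h
        have hc : 0 < c := ((memS _ _ _).1 h).1.1
        simp only [Finset.mem_filter, hs, abs_of_pos hc]
        exact ⟨⟨hc.ne', h⟩, hc⟩
      · rintro ⟨a, c, k⟩ _; rfl
      · rintro ⟨⟨a, k⟩, c⟩ _; rfl
      · rintro ⟨a, c, k⟩ _; rfl
    · refine Finset.sum_bij' (fun p _ => ((p.1, p.2.2), -p.2.1))
        (fun p _ => (p.1.1, -p.2, p.1.2)) ?_ ?_ ?_ ?_ ?_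
      · rintro ⟨a, c, k⟩ h
        simp only [Finset.mem_filter, hs, not_lt] at h
        simpa [abs_of_nonpos h.2] using h.1.2
      · rintro ⟨⟨a, k⟩, c⟩ h
        have hc : 0 < c := ((memS _ _ _).1 h).1.1
        simp only [Finset.mem_filter, hs, abs_neg, abs_of_pos hc]
        exact ⟨⟨by omega, h⟩, by omega⟩
      · rintro ⟨a, c, k⟩ _; simp
      · rintro ⟨⟨a, k⟩, c⟩ _; simp
      · rintro ⟨a, c, k⟩ _; simp
  have h0 := sum_indefinite_eq_zero M
  rw [half] at h0
  · have h1 : ∑ p ∈ S, ((M : ℤ) - 5 * p.2 ^ 2) * p.1.2 + ∑ p ∈ S, (M - 5 * p.2 ^ 2) * p.1.1 =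
        ∑ p ∈ S, 4 * ((p.1.1 * p.1.2 - p.2 ^ 2) * (p.1.1 + p.1.2)) := by
      rw [← Finset.sum_add_distrib]
      refine Finset.sum_congr rfl ?_
      rintro ⟨⟨a, k⟩, c⟩ h
      obtain ⟨_, _, _, _, _, h5⟩ := (memS _ _ _).1 h
      dsimp only
      linear_combination (-(a + k)) * h5
    rw [← Finset.mul_sum] at h1
    linarith
  · intro a c k
    simp only [Set.Finite.mem_toFinset, Set.mem_ofPred_eq, memS, sq_abs, abs_pos]
    constructor
    · rintro ⟨h1, h2, h3, h4, h5, h6⟩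
      refine ⟨by omega, ⟨by omega, ?_⟩, h1, h2, h4, h5, by linarith⟩
      rcases abs_choice c with h | h <;> rw [h] <;> omega
    · rintro ⟨h0, ⟨_, h3⟩, h1, h2, h4, h5, h6⟩
      refine ⟨h1, h2, ?_, h4, h5, by linarith⟩
      rcases abs_choice c with h | h <;> rw [h] at h3 <;> omega

/-- Triples of odd positive integers whose squares add up to `N`. -/
def oddSquareTriples (N : ℤ) : Set (ℤ × ℤ × ℤ) :=
  {t | 0 < t.1 ∧ t.1 % 2 = 1 ∧ 0 < t.2.1 ∧ t.2.1 % 2 = 1 ∧ 0 < t.2.2 ∧ t.2.2 % 2 = 1 ∧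
    t.1 ^ 2 + t.2.1 ^ 2 + t.2.2 ^ 2 = N}

theorem oddSquareTriples_eq_empty (N : ℤ) (hN : N ≤ 0) : oddSquareTriples N = ∅ := by
  ext ⟨x, y, z⟩
  simp only [Set.mem_empty_iff_false, iff_false]
  rintro ⟨h1, _, h2, _, h3, _, h4⟩
  dsimp only at *
  nlinarith

theorem finite_oddSquareTriples (N : ℤ) : (oddSquareTriples N).Finite := by
  refine ((Set.finite_Icc (1 : ℤ) N).prod
    ((Set.finite_Icc (1 : ℤ) N).prod (Set.finite_Icc (1 : ℤ) N))).subset ?_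
  rintro ⟨x, y, z⟩ ⟨h1, _, h2, _, h3, _, h4⟩
  dsimp only at *
  simp only [Set.mem_prod, Set.mem_Icc]
  refine ⟨⟨?_, ?_⟩, ⟨?_, ?_⟩, ?_, ?_⟩ <;> nlinarith

/-- Quadruples of odd positive integers whose squares add up to `N`. -/
def oddSquareQuadruples : ℤ → Set ((ℤ × ℤ × ℤ) × ℤ) := addOddSquare oddSquareTriples

theorem oddSquareQuadruples_eq_empty (N : ℤ) (hN : N ≤ 0) : oddSquareQuadruples N = ∅ :=
  addOddSquare_eq_empty oddSquareTriples_eq_empty N hN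

theorem finite_oddSquareQuadruples (N : ℤ) : (oddSquareQuadruples N).Finite :=
  finite_addOddSquare finite_oddSquareTriples oddSquareTriples_eq_empty N

theorem sum_mul_ncard_oddSquareQuadruples_eq_zero (M : ℕ) :
    ∑ j ∈ Finset.range M, ((M : ℤ) - 5 * (2 * j + 1) ^ 2) *
      (oddSquareQuadruples (M - (2 * j + 1) ^ 2)).ncard = 0 := by
  have key := sum_addOddSquare finite_oddSquareQuadruples oddSquareQuadruples_eq_empty M
    (fun _ c => (M - 5 * c ^ 2))
  simp only [Finset.sum_const, nsmul_eq_mul] at key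
  simp only [Set.ncard_eq_toFinset_card _ (finite_oddSquareQuadruples _)]
  simp only [mul_comm] at key ⊢
  rw [← key]
  set P := (finite_addOddSquare finite_oddSquareQuadruples oddSquareQuadruples_eq_empty M).toFinset
    with hP
  have memP : ∀ x y z w c : ℤ, (((x, y, z), w), c) ∈ P ↔ 0 < c ∧ c % 2 = 1 ∧ 0 < w ∧ w % 2 = 1 ∧
      0 < x ∧ x % 2 = 1 ∧ 0 < y ∧ y % 2 = 1 ∧ 0 < z ∧ z % 2 = 1 ∧
      x ^ 2 + y ^ 2 + z ^ 2 = M - c ^ 2 - w ^ 2 := fun x y z w c => by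
    simp [hP, oddSquareQuadruples, addOddSquare, oddSquareTriples]
  have inv : ∀ (i : ((ℤ × ℤ × ℤ) × ℤ) × ℤ → ((ℤ × ℤ × ℤ) × ℤ) × ℤ),
      (∀ p ∈ P, i p ∈ P) → (∀ p, i (i p) = p) → ∑ p ∈ P, (i p).2 ^ 2 = ∑ p ∈ P, p.2 ^ 2 := by
    intro i h1 h2
    exact Finset.sum_bij' (fun p _ => i p) (fun p _ => i p) h1 h1 (fun p _ => h2 p)
      (fun p _ => h2 p) (fun p _ => rfl)
  have e1 := inv (fun p => (((p.2, p.1.1.2.1, p.1.1.2.2), p.1.2), p.1.1.1)) (by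
    rintro ⟨⟨⟨x, y, z⟩, w⟩, c⟩ h
    simp only [memP] at h ⊢
    obtain ⟨h1, h2, h3, h4, h5, h6, h7, h8, h9, h10, h11⟩ := h
    exact ⟨h5, h6, h3, h4, h1, h2, h7, h8, h9, h10, by linarith⟩) (fun _ => rfl)
  have e2 := inv (fun p => (((p.1.1.1, p.2, p.1.1.2.2), p.1.2), p.1.1.2.1)) (by
    rintro ⟨⟨⟨x, y, z⟩, w⟩, c⟩ h
    simp only [memP] at h ⊢
    obtain ⟨h1, h2, h3, h4, h5, h6, h7, h8, h9, h10, h11⟩ := h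
    exact ⟨h7, h8, h3, h4, h5, h6, h1, h2, h9, h10, by linarith⟩) (fun _ => rfl)
  have e3 := inv (fun p => (((p.1.1.1, p.1.1.2.1, p.2), p.1.2), p.1.1.2.2)) (by
    rintro ⟨⟨⟨x, y, z⟩, w⟩, c⟩ h
    simp only [memP] at h ⊢
    obtain ⟨h1, h2, h3, h4, h5, h6, h7, h8, h9, h10, h11⟩ := h
    exact ⟨h9, h10, h3, h4, h5, h6, h7, h8, h1, h2, by linarith⟩) (fun _ => rfl)
  have e4 := inv (fun p => ((p.1.1, p.2), p.1.2)) (by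
    rintro ⟨⟨⟨x, y, z⟩, w⟩, c⟩ h
    simp only [memP] at h ⊢
    obtain ⟨h1, h2, h3, h4, h5, h6, h7, h8, h9, h10, h11⟩ := h
    exact ⟨h3, h4, h1, h2, h5, h6, h7, h8, h9, h10, by linarith⟩) (fun _ => rfl)
  dsimp only at e1 e2 e3 e4
  have e5 : ∑ p ∈ P, ((M : ℤ) - 5 * p.2 ^ 2) =
      ∑ p ∈ P, (p.1.1.1 ^ 2 + p.1.1.2.1 ^ 2 + p.1.1.2.2 ^ 2 + p.1.2 ^ 2 - 4 * p.2 ^ 2) := by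
    refine Finset.sum_congr rfl ?_
    rintro ⟨⟨⟨x, y, z⟩, w⟩, c⟩ h
    obtain ⟨h1, h2, h3, h4, h5, h6, h7, h8, h9, h10, h11⟩ := (memP _ _ _ _ _).1 h
    dsimp only
    linear_combination -h11
  rw [e5]
  simp only [Finset.sum_sub_distrib, Finset.sum_add_distrib, ← Finset.mul_sum]
  linarith

theorem oddSquareQuadruples_four : oddSquareQuadruples 4 = {((1, 1, 1), 1)} := by
  ext ⟨⟨x, y, z⟩, w⟩
  simp only [oddSquareQuadruples, addOddSquare, oddSquareTriples, Set.mem_ofPred_eq,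
    Set.mem_singleton_iff, Prod.mk.injEq]
  constructor
  · rintro ⟨h1, h2, h3, h4, h5, h6, h7, h8, h9⟩
    refine ⟨⟨?_, ?_, ?_⟩, ?_⟩ <;> nlinarith
  · rintro ⟨⟨rfl, rfl, rfl⟩, rfl⟩
    norm_num

theorem oddFactorizations_four : oddFactorizations 4 = {(1, 1)} := by
  ext ⟨a, k⟩
  simp only [oddFactorizations, Set.mem_ofPred_eq, Set.mem_singleton_iff, Prod.mk.injEq]
  constructor
  · rintro ⟨h1, h2, h3, h4, h5⟩
    constructor <;> nlinarith
  · rintro ⟨rfl, rfl⟩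
    norm_num

theorem oddSigma_four : oddSigma 4 = 1 := by
  have : (finite_oddFactorizations 4).toFinset = {(1, 1)} :=
    Finset.coe_injective (by rw [Set.Finite.coe_toFinset, oddFactorizations_four,
      Finset.coe_singleton])
  rw [oddSigma, this, Finset.sum_singleton]

/-- A triangular recursion: if the weighted sums of `D (M - c²)` over odd `c` vanish, then `D`
vanishes at every `4 n + e` with `n` odd. -/
theorem eq_zero_of_sum_odd_sq {D : ℤ → ℤ} (hD : ∀ N ≤ 0, D N = 0) {e : ℕ} (he : e ≤ 1)
    {w : ℕ → ℕ → ℤ}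
    (hsum : ∀ n : ℕ, n % 2 = 1 → ∑ j ∈ Finset.range (4 * n + e),
      w n j * D ((4 * n + e : ℕ) - (2 * j + 1) ^ 2) = 0)
    (hw : ∀ n, n % 2 = 1 → w n 0 = 0 → D ((4 * n + e : ℕ) - 1) = 0) (n : ℕ) (hn : n % 2 = 1) :
    D ((4 * n + e : ℕ) - 1) = 0 := by
  induction n using Nat.strong_induction_on with
  | _ n ih =>
  have h := hsum n hn
  rw [Finset.sum_eq_single_of_mem 0 (Finset.mem_range.2 (by omega))] at h
  · rcases mul_eq_zero.1 h with h | h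
    · exact hw n hn h
    · simpa using h
  · intro j _ hj
    refine mul_eq_zero_of_right _ ?_
    by_cases hle : j * (j + 1) < n
    · have hev : (j * (j + 1)) % 2 = 0 := Nat.even_iff.1 (Nat.even_mul_succ_self j)
      have hpos : 0 < j * (j + 1) := by positivity
      have := ih (n - j * (j + 1)) (by omega) (by omega)
      rw [← this]
      congr 1
      have : ((n - j * (j + 1) : ℕ) : ℤ) = n - j * (j + 1) := by
        push_cast [Nat.cast_sub hle.le]; ring
      push_cast [this]
      ring
    · refine hD _ ?_
      zify at hle he
      push_cast
      nlinarith

theorem ncard_oddSquareQuadruples (n : ℕ) (hn : n % 2 = 1) :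
    ((oddSquareQuadruples (4 * n)).ncard : ℤ) = oddSigma (4 * n) := by
  have := eq_zero_of_sum_odd_sq (D := fun N => (oddSquareQuadruples N).ncard - oddSigma N)
    ?_ (e := 1) le_rfl (w := fun n j => ((4 * n + 1 : ℕ) : ℤ) - 5 * (2 * j + 1) ^ 2) ?_ ?_ n hn
  · push_cast at this
    rw [add_sub_cancel_right] at this
    linarith
  · intro N hN
    simp [oddSquareQuadruples_eq_empty N hN, oddSigma, oddFactorizations_eq_empty N hN]
  · intro n _
    simp only [mul_sub, Finset.sum_sub_distrib]
    rw [sum_mul_ncard_oddSquareQuadruples_eq_zero, sum_mul_oddSigma_eq_zero, sub_zero]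
  · intro n _ h
    have : n = 1 := by push_cast at h; omega
    subst this
    norm_num
    simp [oddSquareQuadruples_four, oddSigma_four]

/-- Triples `(r, s, t)` of odd positive integers with `r s + s t + t r = N`. -/
def oddSymmTriples (N : ℤ) : Set (ℤ × ℤ × ℤ) :=
  {p | 0 < p.1 ∧ p.1 % 2 = 1 ∧ 0 < p.2.1 ∧ p.2.1 % 2 = 1 ∧ 0 < p.2.2 ∧ p.2.2 % 2 = 1 ∧
    p.1 * p.2.1 + p.2.1 * p.2.2 + p.2.2 * p.1 = N}

theorem oddSymmTriples_eq_empty (N : ℤ) (hN : N ≤ 0) : oddSymmTriples N = ∅ := by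
  ext ⟨x, y, z⟩
  simp only [Set.mem_empty_iff_false, iff_false]
  rintro ⟨h1, _, h2, _, h3, _, h4⟩
  dsimp only at *
  nlinarith [mul_pos h1 h2, mul_pos h2 h3, mul_pos h3 h1]

theorem finite_oddSymmTriples (N : ℤ) : (oddSymmTriples N).Finite := by
  refine ((Set.finite_Icc (1 : ℤ) N).prod
    ((Set.finite_Icc (1 : ℤ) N).prod (Set.finite_Icc (1 : ℤ) N))).subset ?_
  rintro ⟨x, y, z⟩ ⟨h1, _, h2, _, h3, _, h4⟩
  dsimp only at *
  simp only [Set.mem_prod, Set.mem_Icc]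
  refine ⟨⟨?_, ?_⟩, ⟨?_, ?_⟩, ?_, ?_⟩ <;>
    nlinarith [mul_pos h1 h2, mul_pos h2 h3, mul_pos h3 h1]

theorem Int.exists_sq_eq_of_mod_two_eq_one {c : ℤ} (hc : c % 2 = 1) : ∃ u, c ^ 2 = 8 * u + 1 := by
  obtain ⟨d, rfl⟩ : ∃ d, c = 2 * d + 1 := ⟨c / 2, by omega⟩
  obtain ⟨u, hu⟩ := (Int.even_mul_succ_self d).two_dvd
  exact ⟨u, by linear_combination 4 * hu⟩

theorem Int.exists_mul_add_eq {g k : ℤ} (hk : k % 2 = 1) : ∃ u, g * (g + k) = 2 * u := by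
  obtain ⟨d, rfl⟩ : ∃ d, k = 2 * d + 1 := ⟨k / 2, by omega⟩
  obtain ⟨u, hu⟩ := (Int.even_mul_succ_self g).two_dvd
  exact ⟨u + g * d, by linear_combination hu⟩

theorem Int.mod_two_eq_one_of_mul {c m : ℤ} (h : c * m % 2 = 1) : m % 2 = 1 :=
  Int.odd_iff.1 (Int.odd_mul.1 (Int.odd_iff.2 h)).2

/-- Quadruples `(a, c, k, l)` of odd positive integers with `(a + e c)² + 2 a k + 2 c l = 4 n`. -/
def kroneckerQuadruples (e n : ℤ) : Set (ℤ × ℤ × ℤ × ℤ) :=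
  {p | 0 < p.1 ∧ p.1 % 2 = 1 ∧ 0 < p.2.1 ∧ p.2.1 % 2 = 1 ∧ 0 < p.2.2.1 ∧ p.2.2.1 % 2 = 1 ∧
    0 < p.2.2.2 ∧ p.2.2.2 % 2 = 1 ∧
    (p.1 + e * p.2.1) ^ 2 + 2 * p.1 * p.2.2.1 + 2 * p.2.1 * p.2.2.2 = 4 * n}

/-- Quadruples `(g, k, c, m)` of positive integers with `k`, `c`, `m` odd and
`g (g + k) + c m = n`. -/
def kroneckerReduced (n : ℤ) : Set (ℤ × ℤ × ℤ × ℤ) :=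
  {p | 0 < p.1 ∧ 0 < p.2.1 ∧ p.2.1 % 2 = 1 ∧ 0 < p.2.2.1 ∧ p.2.2.1 % 2 = 1 ∧
    0 < p.2.2.2 ∧ p.2.2.2 % 2 = 1 ∧ p.1 * (p.1 + p.2.1) + p.2.2.1 * p.2.2.2 = n}

theorem finite_kroneckerQuadruples (e n : ℤ) : (kroneckerQuadruples e n).Finite := by
  have := Set.finite_Icc (1 : ℤ) (4 * n)
  refine (this.prod (this.prod (this.prod this))).subset ?_
  rintro ⟨a, c, k, l⟩ ⟨h1, _, h2, _, h3, _, h4, _, h5⟩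
  dsimp only at *
  have := mul_pos h1 h3
  have := mul_pos h2 h4
  simp only [Set.mem_prod, Set.mem_Icc]
  refine ⟨⟨?_, ?_⟩, ⟨?_, ?_⟩, ⟨?_, ?_⟩, ?_, ?_⟩ <;> nlinarith [sq_nonneg (a + e * c)]

theorem finite_kroneckerReduced (n : ℤ) : (kroneckerReduced n).Finite := by
  have := Set.finite_Icc (1 : ℤ) n
  refine (this.prod (this.prod (this.prod this))).subset ?_
  rintro ⟨g, k, c, m⟩ ⟨h1, h2, _, h3, _, h4, _, h5⟩
  dsimp only at *
  have := mul_pos h1 h2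
  have := mul_pos h3 h4
  simp only [Set.mem_prod, Set.mem_Icc]
  refine ⟨⟨?_, ?_⟩, ⟨?_, ?_⟩, ⟨?_, ?_⟩, ?_, ?_⟩ <;> nlinarith

theorem ncard_addOddSquare_oddSymmTriples_eq (n : ℤ) (hn : n % 2 = 1) :
    (addOddSquare oddSymmTriples (4 * n)).ncard =
      {p ∈ kroneckerQuadruples (-1) n | p.2.2.2 < 2 * p.1}.ncard := by
  refine Set.ncard_eq_of_inverse
    (fun p => if p.1.1 - p.1.2.1 < 2 * p.2 then
      ((p.1.1 + p.1.2.1) / 2, p.2 - (p.1.1 - p.1.2.1) / 2, p.1.2.2, p.1.1) else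
      ((p.1.1 + p.1.2.1) / 2, (p.1.1 - p.1.2.1) / 2 - p.2, p.1.2.2, p.1.2.1))
    (fun p => if 0 < p.2.1 + p.2.2.2 - p.1 then
      ((p.2.2.2, 2 * p.1 - p.2.2.2, p.2.2.1), p.2.1 + p.2.2.2 - p.1) else
      ((2 * p.1 - p.2.2.2, p.2.2.2, p.2.2.1), p.1 - p.2.2.2 - p.2.1)) ?_ ?_
  · rintro ⟨⟨r, s, t⟩, c⟩ ⟨hc, hc2, hr, hr2, hs, hs2, ht, ht2, h⟩
    dsimp only at *
    obtain ⟨a, ha⟩ : ∃ a, r + s = 2 * a := ⟨(r + s) / 2, by omega⟩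
    obtain ⟨f, rfl⟩ : ∃ f, r = a + f := ⟨r - a, by omega⟩
    obtain rfl : s = a - f := by omega
    have ha2 : a % 2 = 1 := by
      by_contra hcon
      obtain ⟨b, rfl⟩ : ∃ b, a = 2 * b := ⟨a / 2, by omega⟩
      obtain ⟨u, hu⟩ := Int.exists_sq_eq_of_mod_two_eq_one hc2
      obtain ⟨v, hv⟩ := Int.exists_sq_eq_of_mod_two_eq_one (c := f) (by omega)
      obtain ⟨w, hw⟩ := Int.exists_mul_add_eq (g := b) ht2
      have : 8 * w - 8 * v - 1 = 4 * n - 8 * u - 1 := by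
        linear_combination h - 4 * hw + hv - hu
      omega
    have e1 : (a + f + (a - f)) / 2 = a := by omega
    have e2 : (a + f - (a - f)) / 2 = f := by omega
    simp only [e1, e2]
    by_cases h1 : a + f - (a - f) < 2 * c
    · rw [if_pos h1]
      refine ⟨⟨⟨by dsimp only; omega, by dsimp only; omega, by dsimp only; omega,
        by dsimp only; omega, ht, ht2, by dsimp only; omega, by dsimp only; omega, ?_⟩,
        by dsimp only; omega⟩, ?_⟩
      · dsimp only; linear_combination h
      · dsimp only
        rw [if_pos (by omega)]
        simp only [Prod.mk.injEq, and_true, true_and]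
        omega
    · rw [if_neg h1]
      refine ⟨⟨⟨by dsimp only; omega, by dsimp only; omega, by dsimp only; omega,
        by dsimp only; omega, ht, ht2, by dsimp only; omega, by dsimp only; omega, ?_⟩,
        by dsimp only; omega⟩, ?_⟩
      · dsimp only; linear_combination h
      · dsimp only
        rw [if_neg (by omega)]
        simp only [Prod.mk.injEq, and_true]
        omega
  · rintro ⟨a, c, k, l⟩ ⟨⟨ha, ha2, hc, hc2, hk, hk2, hl, hl2, h⟩, hlt⟩
    dsimp only at *
    by_cases h1 : 0 < c + l - a
    · rw [if_pos h1]
      refine ⟨⟨h1, by dsimp only; omega, hl, hl2, by dsimp only; omega, by dsimp only; omega,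
        hk, hk2, by dsimp only; linear_combination h⟩, ?_⟩
      dsimp only
      rw [if_pos (by omega)]
      simp only [Prod.mk.injEq, and_true]
      omega
    · rw [if_neg h1]
      refine ⟨⟨by dsimp only; omega, by dsimp only; omega, by dsimp only; omega,
        by dsimp only; omega, hl, hl2, hk, hk2, by dsimp only; linear_combination h⟩, ?_⟩
      dsimp only
      rw [if_neg (by omega)]
      simp only [Prod.mk.injEq, and_true]
      omega

theorem ncard_kroneckerQuadruples_two_mul_le (n : ℤ) :
    {p ∈ kroneckerQuadruples (-1) n | ¬ p.2.2.2 < 2 * p.1}.ncard =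
      (kroneckerQuadruples 1 n).ncard := by
  refine Set.ncard_eq_of_inverse (fun p => (p.1, p.2.1, p.2.2.1, p.2.2.2 - 2 * p.1))
    (fun p => (p.1, p.2.1, p.2.2.1, p.2.2.2 + 2 * p.1)) ?_ ?_
  · rintro ⟨a, c, k, l⟩ ⟨⟨ha, ha2, hc, hc2, hk, hk2, hl, hl2, h⟩, hlt⟩
    dsimp only at *
    refine ⟨⟨ha, ha2, hc, hc2, hk, hk2, ?_, ?_, ?_⟩, ?_⟩ <;> try dsimp only
    · omega
    · omega
    · linear_combination h
    · simp
  · rintro ⟨a, c, k, l⟩ ⟨ha, ha2, hc, hc2, hk, hk2, hl, hl2, h⟩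
    dsimp only at *
    refine ⟨⟨⟨ha, ha2, hc, hc2, hk, hk2, ?_, ?_, ?_⟩, ?_⟩, ?_⟩ <;> try dsimp only
    · omega
    · omega
    · linear_combination h
    · omega
    · simp

theorem ncard_kroneckerQuadruples_lt (n : ℤ) (hn : n % 2 = 1) :
    {p ∈ kroneckerQuadruples (-1) n | p.2.1 < p.1}.ncard =
      {p ∈ kroneckerReduced n | p.2.1 < 2 * p.2.2.2}.ncard := by
  refine Set.ncard_eq_of_inverse
    (fun p => ((p.1 - p.2.1) / 2, p.2.2.1, p.2.1, (p.2.2.1 + p.2.2.2) / 2))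
    (fun p => (p.2.2.1 + 2 * p.1, p.2.2.1, p.2.1, 2 * p.2.2.2 - p.2.1)) ?_ ?_
  · rintro ⟨a, c, k, l⟩ ⟨⟨ha, ha2, hc, hc2, hk, hk2, hl, hl2, h⟩, hlt⟩
    dsimp only at *
    obtain ⟨g, rfl⟩ : ∃ g, a = c + 2 * g := ⟨(a - c) / 2, by omega⟩
    obtain ⟨m, hm⟩ : ∃ m, k + l = 2 * m := ⟨(k + l) / 2, by omega⟩
    obtain rfl : l = 2 * m - k := by omega
    have h' : g * (g + k) + c * m = n := by linarith
    obtain ⟨u, hu⟩ := Int.exists_mul_add_eq (g := g) hk2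
    have hm2 : m % 2 = 1 := Int.mod_two_eq_one_of_mul (c := c) (by omega)
    have e1 : (c + 2 * g - c) / 2 = g := by omega
    have e2 : (k + (2 * m - k)) / 2 = m := by omega
    simp only [e1, e2]
    exact ⟨⟨⟨by dsimp only; omega, hk, hk2, hc, hc2, by dsimp only; omega, hm2, h'⟩,
      by dsimp only; omega⟩, trivial⟩
  · rintro ⟨g, k, c, m⟩ ⟨⟨hg, hk, hk2, hc, hc2, hm, hm2, h⟩, hlt⟩
    dsimp only at *
    have e1 : (c + 2 * g - c) / 2 = g := by omega
    have e2 : (k + (2 * m - k)) / 2 = m := by omega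
    simp only [e1, e2]
    exact ⟨⟨⟨by dsimp only; omega, by dsimp only; omega, hc, hc2, hk, hk2, by dsimp only; omega,
      by dsimp only; omega, by dsimp only; linarith⟩, by dsimp only; omega⟩, trivial⟩

theorem ncard_kroneckerQuadruples_one_lt (n : ℤ) (hn : n % 2 = 1) :
    {p ∈ kroneckerQuadruples 1 n | p.2.2.1 < p.2.2.2}.ncard =
      {p ∈ kroneckerReduced n | p.2.2.1 < 2 * p.1}.ncard := by
  refine Set.ncard_eq_of_inverse
    (fun p => ((p.1 + p.2.1) / 2, p.2.2.1, p.2.1, (p.2.2.2 - p.2.2.1) / 2))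
    (fun p => (2 * p.1 - p.2.2.1, p.2.2.1, p.2.1, p.2.1 + 2 * p.2.2.2)) ?_ ?_
  · rintro ⟨a, c, k, l⟩ ⟨⟨ha, ha2, hc, hc2, hk, hk2, hl, hl2, h⟩, hlt⟩
    dsimp only at *
    obtain ⟨g, hg⟩ : ∃ g, a + c = 2 * g := ⟨(a + c) / 2, by omega⟩
    obtain rfl : a = 2 * g - c := by omega
    obtain ⟨m, rfl⟩ : ∃ m, l = k + 2 * m := ⟨(l - k) / 2, by omega⟩
    have h' : g * (g + k) + c * m = n := by linarith
    obtain ⟨u, hu⟩ := Int.exists_mul_add_eq (g := g) hk2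
    have hm2 : m % 2 = 1 := Int.mod_two_eq_one_of_mul (c := c) (by omega)
    have e1 : (2 * g - c + c) / 2 = g := by omega
    have e2 : (k + 2 * m - k) / 2 = m := by omega
    simp only [e1, e2]
    exact ⟨⟨⟨by dsimp only; omega, hk, hk2, hc, hc2, by dsimp only; omega, hm2, h'⟩,
      by dsimp only; omega⟩, trivial⟩
  · rintro ⟨g, k, c, m⟩ ⟨⟨hg, hk, hk2, hc, hc2, hm, hm2, h⟩, hlt⟩
    dsimp only at *
    have e1 : (2 * g - c + c) / 2 = g := by omega
    have e2 : (k + 2 * m - k) / 2 = m := by omega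
    simp only [e1, e2]
    exact ⟨⟨⟨by dsimp only; omega, by dsimp only; omega, hc, hc2, hk, hk2, by dsimp only; omega,
      by dsimp only; omega, by dsimp only; linarith⟩, by dsimp only; omega⟩, trivial⟩

theorem ncard_kroneckerQuadruples_swap {e : ℤ} (he : e ^ 2 = 1) (n : ℤ)
    {P Q : ℤ × ℤ × ℤ × ℤ → Prop} (hPQ : ∀ a c k l, P (a, c, k, l) ↔ Q (c, a, l, k)) :
    {p ∈ kroneckerQuadruples e n | P p}.ncard = {p ∈ kroneckerQuadruples e n | Q p}.ncard := by
  refine Set.ncard_eq_of_inverse (fun p => (p.2.1, p.1, p.2.2.2, p.2.2.1))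
    (fun p => (p.2.1, p.1, p.2.2.2, p.2.2.1)) ?_ ?_
  · rintro ⟨a, c, k, l⟩ ⟨⟨ha, ha2, hc, hc2, hk, hk2, hl, hl2, h⟩, hlt⟩
    exact ⟨⟨⟨hc, hc2, ha, ha2, hl, hl2, hk, hk2,
      by dsimp only at *; linear_combination h + (a ^ 2 - c ^ 2) * he⟩, (hPQ _ _ _ _).1 hlt⟩, rfl⟩
  · rintro ⟨a, c, k, l⟩ ⟨⟨ha, ha2, hc, hc2, hk, hk2, hl, hl2, h⟩, hlt⟩
    exact ⟨⟨⟨hc, hc2, ha, ha2, hl, hl2, hk, hk2,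
      by dsimp only at *; linear_combination h + (a ^ 2 - c ^ 2) * he⟩, (hPQ _ _ _ _).2 hlt⟩, rfl⟩

theorem ncard_kroneckerReduced_lt (n : ℤ) :
    {p ∈ kroneckerReduced n | p.2.1 < 2 * p.2.2.2}.ncard =
      {p ∈ kroneckerReduced n | p.2.2.1 < 2 * p.1}.ncard := by
  have h1 := (finite_kroneckerReduced n).ncard_eq_add (fun p => p.2.1 < 2 * p.2.2.2)
  have h2 := (finite_kroneckerReduced n).ncard_eq_add (fun p => p.2.2.1 < 2 * p.1)
  have h3 : {p ∈ kroneckerReduced n | ¬ p.2.1 < 2 * p.2.2.2}.ncard =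
      {p ∈ kroneckerReduced n | ¬ p.2.2.1 < 2 * p.1}.ncard := by
    refine Set.ncard_eq_of_inverse
      (fun p => (p.1, p.2.1 - 2 * p.2.2.2, p.2.2.1 + 2 * p.1, p.2.2.2))
      (fun p => (p.1, p.2.1 + 2 * p.2.2.2, p.2.2.1 - 2 * p.1, p.2.2.2)) ?_ ?_
    all_goals
      rintro ⟨g, k, c, m⟩ ⟨⟨hg, hk, hk2, hc, hc2, hm, hm2, h⟩, hlt⟩
      dsimp only at *
      exact ⟨⟨⟨hg, by dsimp only; omega, by dsimp only; omega, by dsimp only; omega,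
        by dsimp only; omega, hm, hm2, by dsimp only; linear_combination h⟩,
        by dsimp only; omega⟩, by simp⟩
  omega

theorem ncard_kroneckerQuadruples_eq (n : ℤ) (hn : n % 2 = 1) :
    ({p ∈ kroneckerQuadruples (-1) n | p.1 = p.2.1}.ncard : ℤ) = oddSigma (4 * n) := by
  have h : {p ∈ kroneckerQuadruples (-1) n | p.1 = p.2.1}.ncard =
      (((finite_oddFactorizations (4 * n)).toFinset.sigma fun p => Finset.range p.2.toNat :
        Finset (Σ _ : ℤ × ℤ, ℕ)) : Set (Σ _ : ℤ × ℤ, ℕ)).ncard := by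
    refine Set.ncard_eq_of_inverse
      (fun p => ⟨(p.1, (p.2.2.1 + p.2.2.2) / 2), (p.2.2.1 / 2).toNat⟩)
      (fun q => (q.1.1, q.1.1, 2 * (q.2 : ℤ) + 1, 2 * q.1.2 - 2 * q.2 - 1)) ?_ ?_
    · rintro ⟨a, c, k, l⟩ ⟨⟨ha, ha2, hc, hc2, hk, hk2, hl, hl2, h⟩, hlt⟩
      dsimp only at *
      subst hlt
      obtain ⟨m, hm⟩ : ∃ m, k + l = 2 * m := ⟨(k + l) / 2, by omega⟩
      obtain rfl : l = 2 * m - k := by omega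
      have h' : a * m = n := by linarith
      have hm2 : m % 2 = 1 := Int.mod_two_eq_one_of_mul (c := a) (by omega)
      have e2 : (k + (2 * m - k)) / 2 = m := by omega
      simp only [e2, Finset.coe_sigma, Set.mem_sigma_iff, Finset.mem_coe, Set.Finite.mem_toFinset,
        Finset.mem_range, Prod.mk.injEq]
      exact ⟨⟨⟨ha, ha2, by dsimp only; omega, hm2, by dsimp only; linarith⟩, by omega⟩,
        trivial, trivial, by omega, by omega⟩
    · rintro ⟨⟨a, m⟩, i⟩ hq
      simp only [Finset.coe_sigma, Set.mem_sigma_iff, Finset.mem_coe, Set.Finite.mem_toFinset,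
        Finset.mem_range] at hq
      obtain ⟨⟨ha, ha2, hm, hm2, h⟩, hi⟩ := hq
      dsimp only at *
      have e1 : (2 * (i : ℤ) + 1 + (2 * m - 2 * i - 1)) / 2 = m := by omega
      have e2 : ((2 * (i : ℤ) + 1) / 2).toNat = i := by omega
      simp only [e1, e2]
      exact ⟨⟨⟨ha, ha2, ha, ha2, by dsimp only; omega, by dsimp only; omega, by dsimp only; omega,
        by dsimp only; omega, by dsimp only; linarith⟩, rfl⟩, trivial⟩
  rw [h, Set.ncard_coe_finset, Finset.card_sigma, oddSigma]
  push_cast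
  refine Finset.sum_congr rfl ?_
  rintro ⟨a, m⟩ hp
  rw [Set.Finite.mem_toFinset] at hp
  simpa using hp.2.2.1.le

theorem ncard_addOddSquare_oddSymmTriples (n : ℤ) (hn : n % 2 = 1) :
    ((addOddSquare oddSymmTriples (4 * n)).ncard : ℤ) = oddSigma (4 * n) := by
  have hX := finite_kroneckerQuadruples (-1) n
  have h1 := hX.ncard_eq_add (fun p => p.2.2.2 < 2 * p.1)
  rw [← ncard_addOddSquare_oddSymmTriples_eq n hn, ncard_kroneckerQuadruples_two_mul_le] at h1
  have h2 := hX.ncard_eq_add (fun p => p.1 = p.2.1)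
  have h3 := (hX.subset (Set.sep_subset _ _)).ncard_eq_add (A := {p ∈ _ | ¬ p.1 = p.2.1})
    (fun p => p.2.1 < p.1)
  have h4 := (finite_kroneckerQuadruples 1 n).ncard_eq_add (fun p => p.2.2.1 < p.2.2.2)
  have s1 : {p ∈ {p ∈ kroneckerQuadruples (-1) n | ¬ p.1 = p.2.1} | p.2.1 < p.1} =
      {p ∈ kroneckerQuadruples (-1) n | p.2.1 < p.1} := by
    ext p
    simp only [Set.mem_ofPred_eq, and_assoc]
    refine and_congr_right fun _ => ?_
    omega
  have s2 : {p ∈ {p ∈ kroneckerQuadruples (-1) n | ¬ p.1 = p.2.1} | ¬ p.2.1 < p.1} =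
      {p ∈ kroneckerQuadruples (-1) n | p.1 < p.2.1} := by
    ext p
    simp only [Set.mem_ofPred_eq, and_assoc]
    refine and_congr_right fun _ => ?_
    omega
  have s3 : {p ∈ kroneckerQuadruples 1 n | ¬ p.2.2.1 < p.2.2.2} =
      {p ∈ kroneckerQuadruples 1 n | p.2.2.2 < p.2.2.1} := by
    ext ⟨a, c, k, l⟩
    simp only [Set.mem_ofPred_eq]
    refine and_congr_right fun hp => ⟨fun hle => ?_, fun hlt => by omega⟩
    obtain ⟨ha, ha2, hc, hc2, hk, hk2, hl, hl2, h⟩ := hp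
    dsimp only at *
    refine lt_of_le_of_ne (by omega) ?_
    rintro rfl
    obtain ⟨g, hg⟩ : ∃ g, a + c = 2 * g := ⟨(a + c) / 2, by omega⟩
    obtain rfl : a = 2 * g - c := by omega
    obtain ⟨u, hu⟩ := Int.exists_mul_add_eq (g := g) hk2
    have : 2 * u = n := by linarith
    omega
  rw [s1, s2, ncard_kroneckerQuadruples_swap (by norm_num) n (P := fun p => p.1 < p.2.1)
    (Q := fun p => p.2.1 < p.1) (fun _ _ _ _ => Iff.rfl), ncard_kroneckerQuadruples_lt n hn,
    ncard_kroneckerReduced_lt] at h3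
  rw [s3, ncard_kroneckerQuadruples_swap (by norm_num) n (P := fun p => p.2.2.2 < p.2.2.1)
    (Q := fun p => p.2.2.1 < p.2.2.2) (fun _ _ _ _ => Iff.rfl),
    ncard_kroneckerQuadruples_one_lt n hn] at h4
  rw [← ncard_kroneckerQuadruples_eq n hn]
  omega

theorem ncard_oddSquareTriples (n : ℕ) (hn : n % 2 = 1) :
    (oddSquareTriples (4 * n - 1)).ncard = (oddSymmTriples (4 * n - 1)).ncard := by
  have := eq_zero_of_sum_odd_sq
    (D := fun N => ((oddSquareTriples N).ncard : ℤ) - (oddSymmTriples N).ncard) ?_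
    (e := 0) zero_le_one (w := fun _ _ => 1) ?_ (fun _ _ h => absurd h one_ne_zero) n hn
  · push_cast at this
    rw [add_zero] at this
    omega
  · intro N hN
    simp [oddSquareTriples_eq_empty N hN, oddSymmTriples_eq_empty N hN]
  · intro n hn
    have h1 := ncard_addOddSquare finite_oddSquareTriples oddSquareTriples_eq_empty (4 * n + 0)
    have h2 := ncard_addOddSquare finite_oddSymmTriples oddSymmTriples_eq_empty (4 * n + 0)
    have h3 := ncard_oddSquareQuadruples n hn
    have h4 := ncard_addOddSquare_oddSymmTriples n (by omega)
    simp only [one_mul, Finset.sum_sub_distrib, ← Nat.cast_sum, ← h1, ← h2]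
    push_cast
    rw [add_zero, h4, ← h3, oddSquareQuadruples, sub_self]

/-- Triples `(r, s, t)` of odd positive integers with `r s + s t + t r = ℓ`, together with a vector
`(x, y)` such that `x > 0`, `y ≥ 0` and `r (x + y)² + s x² + t y² = 2 m`. -/
def sectorReps (ℓ m : ℤ) : Set (ℤ × ℤ × ℤ × ℤ × ℤ) :=
  {p | 0 < p.1 ∧ p.1 % 2 = 1 ∧ 0 < p.2.1 ∧ p.2.1 % 2 = 1 ∧ 0 < p.2.2.1 ∧ p.2.2.1 % 2 = 1 ∧
    p.1 * p.2.1 + p.2.1 * p.2.2.1 + p.2.2.1 * p.1 = ℓ ∧ 0 < p.2.2.2.1 ∧ 0 ≤ p.2.2.2.2 ∧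
    p.1 * (p.2.2.2.1 + p.2.2.2.2) ^ 2 + p.2.1 * p.2.2.2.1 ^ 2 + p.2.2.1 * p.2.2.2.2 ^ 2 = 2 * m}

/-- The analogue of `sectorReps` with `y > 0`, where the condition `s, t > 0` is relaxed to
`r + s, r + t > 0`. -/
def relaxedReps (ℓ m : ℤ) : Set (ℤ × ℤ × ℤ × ℤ × ℤ) :=
  {p | 0 < p.1 ∧ p.1 % 2 = 1 ∧ 0 < p.1 + p.2.1 ∧ p.2.1 % 2 = 1 ∧ 0 < p.1 + p.2.2.1 ∧
    p.2.2.1 % 2 = 1 ∧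
    p.1 * p.2.1 + p.2.1 * p.2.2.1 + p.2.2.1 * p.1 = ℓ ∧ 0 < p.2.2.2.1 ∧ 0 < p.2.2.2.2 ∧
    p.1 * (p.2.2.2.1 + p.2.2.2.2) ^ 2 + p.2.1 * p.2.2.2.1 ^ 2 + p.2.2.1 * p.2.2.2.2 ^ 2 = 2 * m}

/-- Quadruples `(g, r, s, t)` with `g, r, s > 0`, with `r`, `s`, `t` odd, `r s + s t + t r = ℓ` and
`g² (r + s) = 2 m`. -/
def axisReps (ℓ m : ℤ) : Set (ℤ × ℤ × ℤ × ℤ) :=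
  {p | 0 < p.1 ∧ 0 < p.2.1 ∧ p.2.1 % 2 = 1 ∧ 0 < p.2.2.1 ∧ p.2.2.1 % 2 = 1 ∧ p.2.2.2 % 2 = 1 ∧
    p.2.1 * p.2.2.1 + p.2.2.1 * p.2.2.2 + p.2.2.2 * p.2.1 = ℓ ∧
    p.1 ^ 2 * (p.2.1 + p.2.2.1) = 2 * m}

theorem finite_sectorReps (ℓ m : ℤ) : (sectorReps ℓ m).Finite := by
  have h := Set.finite_Icc (0 : ℤ) (2 * m + ℓ)
  refine (h.prod (h.prod (h.prod (h.prod h)))).subset ?_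
  rintro ⟨r, s, t, x, y⟩ ⟨hr, _, hs, _, ht, _, hl, hx, hy, h⟩
  dsimp only at *
  have := mul_pos hr hs
  have := mul_pos hs ht
  have := mul_pos ht hr
  have h1 : (x + y) ^ 2 ≤ r * (x + y) ^ 2 := le_mul_of_one_le_left (sq_nonneg _) hr
  have h2 : x ^ 2 ≤ s * x ^ 2 := le_mul_of_one_le_left (sq_nonneg _) hs
  have h3 : y ^ 2 ≤ t * y ^ 2 := le_mul_of_one_le_left (sq_nonneg _) ht
  simp only [Set.mem_prod, Set.mem_Icc]
  refine ⟨⟨?_, ?_⟩, ⟨?_, ?_⟩, ⟨?_, ?_⟩, ⟨?_, ?_⟩, ?_, ?_⟩ <;> nlinarith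

theorem finite_relaxedReps (ℓ m : ℤ) : (relaxedReps ℓ m).Finite := by
  have h := Set.finite_Icc (-(2 * m) : ℤ) (2 * m)
  refine (h.prod (h.prod (h.prod (h.prod h)))).subset ?_
  rintro ⟨r, s, t, x, y⟩ ⟨hr, _, hs, _, ht, _, hl, hx, hy, h⟩
  dsimp only at *
  have hxy := mul_pos hx hy
  have h1 : x * y ≤ r * (x * y) := le_mul_of_one_le_left hxy.le hr
  have h2 : x ^ 2 ≤ (r + s) * x ^ 2 := le_mul_of_one_le_left (sq_nonneg _) hs
  have h3 : y ^ 2 ≤ (r + t) * y ^ 2 := le_mul_of_one_le_left (sq_nonneg _) ht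
  have h1' : r ≤ r * (x * y) := le_mul_of_one_le_right hr.le hxy
  have h2' : r + s ≤ (r + s) * x ^ 2 := le_mul_of_one_le_right hs.le (by nlinarith)
  have h3' : r + t ≤ (r + t) * y ^ 2 := le_mul_of_one_le_right ht.le (by nlinarith)
  have h4 : 2 * (r * (x * y)) + (r + s) * x ^ 2 + (r + t) * y ^ 2 = 2 * m := by
    linear_combination h
  simp only [Set.mem_prod, Set.mem_Icc]
  refine ⟨⟨?_, ?_⟩, ⟨?_, ?_⟩, ⟨?_, ?_⟩, ⟨?_, ?_⟩, ?_, ?_⟩ <;> nlinarith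

theorem finite_axisReps (ℓ m : ℤ) : (axisReps ℓ m).Finite := by
  have h := Set.finite_Icc (1 : ℤ) (2 * m)
  refine (h.prod (h.prod (h.prod
    (Set.finite_Icc (-(|ℓ| + 4 * m ^ 2)) (|ℓ| + 4 * m ^ 2))))).subset ?_
  rintro ⟨g, r, s, t⟩ ⟨hg, hr, _, hs, _, _, hl, h⟩
  dsimp only at *
  have h1 : g ≤ g ^ 2 := by nlinarith
  have h2 : g ^ 2 ≤ g ^ 2 * (r + s) := le_mul_of_one_le_right (sq_nonneg _) (by omega)
  have h3 : r + s ≤ g ^ 2 * (r + s) := le_mul_of_one_le_left (by omega) (by nlinarith)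
  have h4 : r * s ≤ 4 * m ^ 2 := by nlinarith
  have h5 : |t| ≤ |t * (r + s)| := by
    rw [abs_mul]
    exact le_mul_of_one_le_right (abs_nonneg _) (by rw [abs_of_pos] <;> omega)
  have h6 : |t * (r + s)| ≤ |ℓ| + r * s := by
    have : t * (r + s) = ℓ - r * s := by linear_combination hl
    rw [this]
    refine (abs_sub _ _).trans ?_
    rw [abs_of_pos (mul_pos hr hs)]
  simp only [Set.mem_prod, Set.mem_Icc]
  have h7 := abs_le.1 (h5.trans (h6.trans (add_le_add_right h4 _)))
  refine ⟨⟨?_, ?_⟩, ⟨?_, ?_⟩, ⟨?_, ?_⟩, h7⟩ <;> omega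

theorem ncard_sectorReps_eq_zero (ℓ m : ℤ) :
    {p ∈ sectorReps ℓ m | p.2.2.2.2 = 0}.ncard = {p ∈ axisReps ℓ m | 0 < p.2.2.2}.ncard := by
  refine Set.ncard_eq_of_inverse (fun p => (p.2.2.2.1, p.1, p.2.1, p.2.2.1))
    (fun p => (p.2.1, p.2.2.1, p.2.2.2, p.1, 0)) ?_ ?_
  · rintro ⟨r, s, t, x, y⟩ ⟨⟨hr, hr2, hs, hs2, ht, ht2, hl, hx, hy, h⟩, hy0⟩
    dsimp only at *
    subst hy0
    exact ⟨⟨⟨hx, hr, hr2, hs, hs2, ht2, hl, by dsimp only; linear_combination h⟩, ht⟩, rfl⟩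
  · rintro ⟨g, r, s, t⟩ ⟨⟨hg, hr, hr2, hs, hs2, ht2, hl, h⟩, ht⟩
    exact ⟨⟨⟨hr, hr2, hs, hs2, ht, ht2, hl, hg, le_rfl,
      by dsimp only at *; linear_combination h⟩, rfl⟩, rfl⟩

theorem ncard_relaxedReps_eq (ℓ m : ℤ) (hℓ : 0 < ℓ) :
    {p ∈ relaxedReps ℓ m | p.2.2.2.1 = p.2.2.2.2}.ncard =
      {p ∈ axisReps ℓ m | ¬ 0 < p.2.2.2}.ncard := by
  refine Set.ncard_eq_of_inverse
    (fun p => (p.2.2.2.1, 2 * p.1 + p.2.1, 2 * p.1 + p.2.2.1, -p.1))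
    (fun p => (-p.2.2.2, p.2.1 + 2 * p.2.2.2, p.2.2.1 + 2 * p.2.2.2, p.1, p.1)) ?_ ?_
  · rintro ⟨r, s, t, x, y⟩ ⟨⟨hr, hr2, hs, hs2, ht, ht2, hl, hx, hy, h⟩, hxy⟩
    dsimp only at *
    subst hxy
    refine ⟨⟨⟨hx, ?_, ?_, ?_, ?_, ?_, ?_, ?_⟩, ?_⟩, ?_⟩ <;> try dsimp only
    · omega
    · omega
    · omega
    · omega
    · omega
    · linear_combination hl
    · linear_combination h
    · omega
    · simp only [Prod.mk.injEq, and_true]; omega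
  · rintro ⟨g, r, s, t⟩ ⟨⟨hg, hr, hr2, hs, hs2, ht2, hl, h⟩, ht⟩
    dsimp only at *
    have hpos : 0 < r + t ∧ 0 < s + t := by
      constructor <;> by_contra hcon <;> nlinarith
    refine ⟨⟨⟨?_, ?_, ?_, ?_, ?_, ?_, ?_, hg, hg, ?_⟩, rfl⟩, ?_⟩ <;> try dsimp only
    · omega
    · omega
    · omega
    · omega
    · omega
    · omega
    · linear_combination hl
    · linear_combination h
    · simp only [Prod.mk.injEq, true_and]; omega

theorem ncard_relaxedReps_ne (ℓ m : ℤ) (hℓ : 0 < ℓ) :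
    {p ∈ relaxedReps ℓ m | ¬ p.2.2.2.1 = p.2.2.2.2}.ncard =
      {p ∈ relaxedReps ℓ m | ¬ (0 < p.2.1 ∧ 0 < p.2.2.1)}.ncard := by
  refine Set.ncard_eq_of_inverse
    (fun p => if p.2.2.2.2 < p.2.2.2.1 then
      (2 * p.1 + p.2.1, -p.1, p.2.2.1 + 2 * p.1, p.2.2.2.1 - p.2.2.2.2, p.2.2.2.2) else
      (2 * p.1 + p.2.2.1, p.2.1 + 2 * p.1, -p.1, p.2.2.2.1, p.2.2.2.2 - p.2.2.2.1))
    (fun p => if p.2.1 < 0 then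
      (-p.2.1, p.1 + 2 * p.2.1, p.2.2.1 + 2 * p.2.1, p.2.2.2.1 + p.2.2.2.2, p.2.2.2.2) else
      (-p.2.2.1, p.2.1 + 2 * p.2.2.1, p.1 + 2 * p.2.2.1, p.2.2.2.1, p.2.2.2.1 + p.2.2.2.2)) ?_ ?_
  · rintro ⟨r, s, t, x, y⟩ ⟨⟨hr, hr2, hs, hs2, ht, ht2, hl, hx, hy, h⟩, hxy⟩
    dsimp only at *
    by_cases h1 : y < x
    · rw [if_pos h1, if_pos (by dsimp only; omega)]
      refine ⟨⟨⟨?_, ?_, ?_, ?_, ?_, ?_, ?_, ?_, ?_, ?_⟩, ?_⟩, ?_⟩ <;> try dsimp only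
      all_goals try omega
      · linear_combination hl
      · linear_combination h
      · simp only [Prod.mk.injEq, and_true]; omega
    · rw [if_neg h1, if_neg (by dsimp only; omega)]
      refine ⟨⟨⟨?_, ?_, ?_, ?_, ?_, ?_, ?_, ?_, ?_, ?_⟩, ?_⟩, ?_⟩ <;> try dsimp only
      all_goals try omega
      · linear_combination hl
      · linear_combination h
      · simp only [Prod.mk.injEq, true_and]; omega
  · rintro ⟨r, s, t, x, y⟩ ⟨⟨hr, hr2, hs, hs2, ht, ht2, hl, hx, hy, h⟩, hst⟩
    dsimp only at *
    have hpos : 0 < s + t := by nlinarith [sq_nonneg s]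
    by_cases h1 : s < 0
    · rw [if_pos h1, if_pos (by dsimp only; omega)]
      refine ⟨⟨⟨?_, ?_, ?_, ?_, ?_, ?_, ?_, ?_, ?_, ?_⟩, ?_⟩, ?_⟩ <;> try dsimp only
      all_goals try omega
      · linear_combination hl
      · linear_combination h
      · simp only [Prod.mk.injEq, and_true]; omega
    · rw [if_neg h1, if_neg (by dsimp only; omega)]
      refine ⟨⟨⟨?_, ?_, ?_, ?_, ?_, ?_, ?_, ?_, ?_, ?_⟩, ?_⟩, ?_⟩ <;> try dsimp only
      all_goals try omega
      · linear_combination hl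
      · linear_combination h
      · simp only [Prod.mk.injEq, true_and]; omega

theorem ncard_sectorReps (ℓ m : ℤ) (hℓ : 0 < ℓ) :
    (sectorReps ℓ m).ncard = (axisReps ℓ m).ncard := by
  have h1 := (finite_sectorReps ℓ m).ncard_eq_add (fun p => p.2.2.2.2 = 0)
  have h2 := (finite_axisReps ℓ m).ncard_eq_add (fun p => 0 < p.2.2.2)
  have h3 := (finite_relaxedReps ℓ m).ncard_eq_add (fun p => p.2.2.2.1 = p.2.2.2.2)
  have h4 := (finite_relaxedReps ℓ m).ncard_eq_add (fun p => 0 < p.2.1 ∧ 0 < p.2.2.1)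
  have h5 : {p ∈ sectorReps ℓ m | ¬ p.2.2.2.2 = 0} =
      {p ∈ relaxedReps ℓ m | 0 < p.2.1 ∧ 0 < p.2.2.1} := by
    ext ⟨r, s, t, x, y⟩
    constructor
    · rintro ⟨⟨hr, hr2, hs, hs2, ht, ht2, hl, hx, hy, h⟩, hy0⟩
      dsimp only at *
      exact ⟨⟨hr, hr2, by dsimp only; omega, hs2, by dsimp only; omega, ht2, hl, hx,
        by dsimp only; omega, h⟩, hs, ht⟩
    · rintro ⟨⟨hr, hr2, -, hs2, -, ht2, hl, hx, hy, h⟩, hs, ht⟩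
      exact ⟨⟨hr, hr2, hs, hs2, ht, ht2, hl, hx, hy.le, h⟩, hy.ne'⟩
  rw [h5, ncard_sectorReps_eq_zero] at h1
  rw [ncard_relaxedReps_eq ℓ m hℓ, ncard_relaxedReps_ne ℓ m hℓ] at h3
  omega

/-- The residues `b < m` with `m ∣ b² + b + k`. -/
def quadRoots (k m : ℕ) : Finset ℕ :=
  (Finset.range m).filter fun b => m ∣ b ^ 2 + b + k

theorem ncard_axisReps {ℓ k m : ℕ} (hk : 4 * k = ℓ + 1) (hm : 0 < m) :
    (axisReps ℓ m).ncard = ∑ p ∈ m.divisorsAntidiagonal with IsSquare p.1,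
      (quadRoots k p.2).card := by
  rw [← Finset.card_sigma, ← Set.ncard_coe_finset]
  refine Set.ncard_eq_of_inverse
    (fun p => ⟨(p.1.toNat ^ 2, m / p.1.toNat ^ 2), (p.2.1 / 2).toNat⟩)
    (fun q => ((Nat.sqrt q.1.1 : ℤ), 2 * (q.2 : ℤ) + 1, 2 * (q.1.2 : ℤ) - 2 * q.2 - 1,
      2 * ((q.2 ^ 2 + q.2 + k : ℕ) / (q.1.2 : ℕ) : ℕ) - (2 * (q.2 : ℤ) + 1))) ?_ ?_
  · rintro ⟨g, r, s, t⟩ ⟨hg, hr, hr2, hs, hs2, ht2, hl, h⟩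
    dsimp only at *
    lift g to ℕ using hg.le
    obtain ⟨v, hv⟩ : ∃ v, r + s = 2 * v := ⟨(r + s) / 2, by omega⟩
    obtain ⟨b, rfl⟩ : ∃ b, r = 2 * b + 1 := ⟨r / 2, by omega⟩
    obtain ⟨w, hw⟩ : ∃ w, t + (2 * b + 1) = 2 * w := ⟨(t + (2 * b + 1)) / 2, by omega⟩
    lift v to ℕ using by omega
    lift b to ℕ using by omega
    obtain rfl : s = 2 * v - 2 * b - 1 := by omega
    obtain rfl : t = 2 * w - (2 * b + 1) := by omega
    have hk' : (4 * k : ℤ) = ℓ + 1 := by exact_mod_cast hk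
    have h1 : (v : ℤ) * w = b ^ 2 + b + k := by linarith
    have hv0 : 0 < v := by omega
    have hw0 : 0 ≤ w := by
      by_contra hcon
      nlinarith
    lift w to ℕ using hw0
    have h1' : b ^ 2 + b + k = v * w := by exact_mod_cast h1.symm
    have h2 : g ^ 2 * v = m := by
      have : (g : ℤ) ^ 2 * v = m := by linarith
      exact_mod_cast this
    have hg0 : 0 < g := by exact_mod_cast hg
    have e1 : m / g ^ 2 = v := by rw [← h2]; exact Nat.mul_div_cancel_left _ (by positivity)
    have e2 : ((2 * (b : ℤ) + 1) / 2).toNat = b := by omega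
    have e3 : (b ^ 2 + b + k) / v = w := by rw [h1']; exact Nat.mul_div_cancel_left _ hv0
    have e4 : Nat.sqrt (g ^ 2) = g := Nat.sqrt_eq' g
    simp only [Int.toNat_natCast, e1, e2, e3, e4, Finset.coe_sigma, Set.mem_sigma_iff,
      Finset.mem_coe, Finset.mem_filter, Nat.mem_divisorsAntidiagonal, quadRoots, Finset.mem_range,
      and_true]
    exact ⟨⟨⟨h2, hm.ne'⟩, ⟨g, sq g⟩⟩, by omega, ⟨w, h1'⟩⟩
  · rintro ⟨⟨u, v⟩, b⟩ hq
    simp only [Finset.coe_sigma, Set.mem_sigma_iff,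
      Finset.mem_coe, Finset.mem_filter, Nat.mem_divisorsAntidiagonal, quadRoots,
      Finset.mem_range] at hq
    obtain ⟨⟨⟨h2, -⟩, ⟨g, rfl⟩⟩, hb, ⟨w, h1⟩⟩ := hq
    rw [← sq] at h2 ⊢
    have hg0 : 0 < g := by
      rcases Nat.eq_zero_or_pos g with rfl | h
      · simp at h2; omega
      · exact h
    have hv0 : 0 < v := by omega
    have e1 : m / g ^ 2 = v := by rw [← h2]; exact Nat.mul_div_cancel_left _ (by positivity)
    have e2 : ((2 * (b : ℤ) + 1) / 2).toNat = b := by omega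
    have e3 : (b ^ 2 + b + k) / v = w := by rw [h1]; exact Nat.mul_div_cancel_left _ hv0
    have e4 : Nat.sqrt (g ^ 2) = g := Nat.sqrt_eq' g
    have h1' : (b : ℤ) ^ 2 + b + k = v * w := by exact_mod_cast h1
    have h2' : (g : ℤ) ^ 2 * v = m := by exact_mod_cast h2
    have hk' : (4 * k : ℤ) = ℓ + 1 := by exact_mod_cast hk
    simp only [Int.toNat_natCast, e1, e2, e3, e4]
    refine ⟨⟨?_, ?_, ?_, ?_, ?_, ?_, ?_, ?_⟩, trivial⟩ <;> dsimp only
    · omega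
    · omega
    · omega
    · omega
    · omega
    · omega
    · linear_combination hk' - 4 * h1'
    · linear_combination 2 * h2'

theorem card_quadRoots_eq (k m : ℕ) [NeZero m] :
    (quadRoots k m).card = Nat.card {z : ZMod m // z ^ 2 + z + k = 0} := by
  rw [← Set.ncard_coe_finset]
  refine Set.ncard_eq_of_inverse (A := ((quadRoots k m : Finset ℕ) : Set ℕ))
    (B := {z : ZMod m | z ^ 2 + z + k = 0}) (fun b => (b : ZMod m)) ZMod.val ?_ ?_
  · intro b hb
    simp only [quadRoots, Finset.coe_filter, Finset.mem_range, Set.mem_ofPred_eq] at hb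
    refine ⟨?_, ZMod.val_cast_of_lt hb.1⟩
    have := (ZMod.natCast_eq_zero_iff _ _).2 hb.2
    push_cast at this
    exact this
  · intro z hz
    refine ⟨?_, ZMod.natCast_zmod_val z⟩
    simp only [quadRoots, Finset.coe_filter, Finset.mem_range, Set.mem_ofPred_eq]
    refine ⟨ZMod.val_lt z, (ZMod.natCast_eq_zero_iff _ _).1 ?_⟩
    push_cast
    rw [ZMod.natCast_zmod_val]
    exact hz

theorem card_quadRoots_mul (k : ℕ) {m n : ℕ} (hm : m ≠ 0) (hn : n ≠ 0) (h : m.Coprime n) :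
    (quadRoots k (m * n)).card = (quadRoots k m).card * (quadRoots k n).card := by
  have := NeZero.mk hm
  have := NeZero.mk hn
  have := NeZero.mk (mul_ne_zero hm hn)
  simp only [card_quadRoots_eq]
  rw [← Nat.card_prod]
  let e := ZMod.chineseRemainder h
  have he : ∀ z : ZMod (m * n), z ^ 2 + z + k = 0 ↔
      ((e z).1 ^ 2 + (e z).1 + k = 0 ∧ (e z).2 ^ 2 + (e z).2 + k = 0) := by
    intro z
    rw [← e.map_eq_zero_iff, Prod.ext_iff]
    simp
  exact Nat.card_congr
    { toFun := fun z => (⟨(e z).1, ((he z).1 z.2).1⟩, ⟨(e z).2, ((he z).1 z.2).2⟩)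
      invFun := fun w => ⟨e.symm (w.1, w.2), (he _).2 (by simpa using ⟨w.1.2, w.2.2⟩)⟩
      left_inv := fun z => by simp
      right_inv := fun w => by simp }

theorem card_quadRoots_one (k : ℕ) : (quadRoots k 1).card = 1 := by
  simp [quadRoots]

theorem exists_pow_dvd_quadratic {p k : ℤ} (hp : Prime p) (h4 : ¬ p ∣ 4 * k - 1) {b : ℤ}
    (hb : p ∣ b ^ 2 + b + k) (j : ℕ) : ∃ z : ℤ, p ^ (j + 1) ∣ z ^ 2 + z + k := by
  induction j with
  | zero => exact ⟨b, by simpa using hb⟩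
  | succ j ih =>
    obtain ⟨z, c, hc⟩ := ih
    have hz : ¬ p ∣ 2 * z + 1 := by
      intro h
      refine h4 ?_
      have h1 : p ∣ z ^ 2 + z + k := hc ▸ (dvd_pow_self p j.succ_ne_zero).mul_right c
      have := (h1.mul_left 4).sub (h.mul_left (2 * z + 1))
      exact this.trans (dvd_of_eq (by ring))
    obtain ⟨u, v, huv⟩ := (Prime.coprime_iff_not_dvd hp).2 hz
    refine ⟨z - p ^ (j + 1) * c * v, c * u + p ^ j * c ^ 2 * v ^ 2, ?_⟩
    linear_combination hc + (-c * p ^ (j + 1)) * huv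

theorem card_quadRoots_pow_eq_two {p k : ℕ} (hp : p.Prime) (h4 : ¬ (p : ℤ) ∣ 4 * k - 1) {b : ℤ}
    (hb : (p : ℤ) ∣ b ^ 2 + b + k) (j : ℕ) : (quadRoots k (p ^ (j + 1))).card = 2 := by
  have hp' : Prime (p : ℤ) := Nat.prime_iff_prime_int.1 hp
  have := NeZero.mk (pow_ne_zero (j + 1) hp.ne_zero)
  obtain ⟨a, ha⟩ := exists_pow_dvd_quadratic hp' h4 hb j
  have ha2 : ¬ (p : ℤ) ∣ 2 * a + 1 := by
    intro h
    refine h4 ?_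
    have h1 : (p : ℤ) ∣ a ^ 2 + a + k := (dvd_pow_self _ j.succ_ne_zero).trans ha
    have := (h1.mul_left 4).sub (h.mul_left (2 * a + 1))
    exact this.trans (dvd_of_eq (by ring))
  have hmem : ∀ z : ℤ, (z : ZMod (p ^ (j + 1))) ^ 2 + z + k = 0 ↔
      (p : ℤ) ^ (j + 1) ∣ z ^ 2 + z + k := by
    intro z
    rw [← Nat.cast_pow, ← ZMod.intCast_zmod_eq_zero_iff_dvd]
    push_cast
    rfl
  have heq : ∀ x y : ℤ, (x : ZMod (p ^ (j + 1))) = y ↔ (p : ℤ) ^ (j + 1) ∣ x - y := by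
    intro x y
    rw [← Nat.cast_pow, ← ZMod.intCast_zmod_eq_zero_iff_dvd, Int.cast_sub, sub_eq_zero]
  have hset : {z : ZMod (p ^ (j + 1)) | z ^ 2 + z + k = 0} =
      {(a : ZMod (p ^ (j + 1))), ((-1 - a : ℤ) : ZMod (p ^ (j + 1)))} := by
    ext z
    obtain ⟨z, rfl⟩ := ZMod.intCast_surjective z
    simp only [Set.mem_ofPred_eq, Set.mem_insert_iff, Set.mem_singleton_iff, hmem, heq]
    constructor
    · intro hz
      have hmul : (p : ℤ) ^ (j + 1) ∣ (z - a) * (z - (-1 - a)) := by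
        exact (hz.sub ha).trans (dvd_of_eq (by ring))
      by_cases h : (p : ℤ) ∣ z - a
      · refine Or.inl (IsCoprime.dvd_of_dvd_mul_right (z := z - (-1 - a)) ?_ hmul)
        refine IsCoprime.pow_left ((Prime.coprime_iff_not_dvd hp').2 fun h' => ha2 ?_)
        exact (h'.sub h).trans (dvd_of_eq (by ring))
      · exact Or.inr (IsCoprime.dvd_of_dvd_mul_left
          (IsCoprime.pow_left ((Prime.coprime_iff_not_dvd hp').2 h)) hmul)
    · rintro (h | h)
      · exact ((h.mul_right (z + a + 1)).add ha).trans (dvd_of_eq (by ring))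
      · exact ((h.mul_right (z - a)).add ha).trans (dvd_of_eq (by ring))
  rw [card_quadRoots_eq]
  change Set.ncard {z : ZMod (p ^ (j + 1)) | z ^ 2 + z + k = 0} = 2
  rw [hset, Set.ncard_pair]
  rw [Ne, heq]
  intro h
  exact ha2 ((dvd_pow_self _ j.succ_ne_zero).trans (h.trans (dvd_of_eq (by ring))))

theorem card_quadRoots_pow_eq_zero {p k : ℕ} (h : ∀ b : ℤ, ¬ (p : ℤ) ∣ b ^ 2 + b + k) (j : ℕ) :
    (quadRoots k (p ^ (j + 1))).card = 0 := by
  simp only [quadRoots, Finset.card_eq_zero, Finset.filter_eq_empty_iff]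
  intro b _ hb
  refine h b ?_
  exact_mod_cast (dvd_pow_self p j.succ_ne_zero).trans hb

theorem legendreSym_neg_of_mod_four_eq_three {ℓ p : ℕ} [Fact ℓ.Prime] [Fact p.Prime]
    (hℓ : ℓ % 4 = 3) (hp : p ≠ 2) : legendreSym p (-ℓ) = legendreSym ℓ p := by
  have hodd := (Fact.out : p.Prime).eq_two_or_odd.resolve_left hp
  rw [← neg_one_mul, legendreSym.mul, legendreSym.at_neg_one hp]
  rcases Nat.odd_mod_four_iff.1 hodd with h | h
  · rw [ZMod.χ₄_nat_one_mod_four h, one_mul]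
    exact (legendreSym.quadratic_reciprocity_one_mod_four h (by omega)).symm
  · rw [ZMod.χ₄_nat_three_mod_four h, legendreSym.quadratic_reciprocity_three_mod_four hℓ h]
    ring

theorem card_quadRoots_prime_pow {ℓ k p : ℕ} [Fact ℓ.Prime] (h8 : ℓ % 8 = 3)
    (hk : 4 * k = ℓ + 1) (hp : p.Prime) (j : ℕ) :
    ((quadRoots k (p ^ (j + 1))).card : ℤ) = legendreSym ℓ p ^ j * (1 + legendreSym ℓ p) := by
  have hk' : (4 * k : ℤ) = ℓ + 1 := by exact_mod_cast hk
  have hℓ : ℓ.Prime := Fact.out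
  by_cases hp2 : p = 2
  · subst hp2
    have : legendreSym ℓ (2 : ℕ) = -1 := by
      rw [Nat.cast_ofNat, legendreSym.at_two (by omega), ZMod.χ₈_nat_eq_if_mod_eight]
      simp [h8]; omega
    rw [this, card_quadRoots_pow_eq_zero]
    · simp
    · intro b hb
      obtain ⟨u, hu⟩ := (Int.even_mul_succ_self b).two_dvd
      push_cast at hb
      have : b ^ 2 + b + k = 2 * u + k := by linear_combination hu
      omega
  by_cases hpl : p = ℓ
  · subst hpl
    have : legendreSym p (p : ℕ) = 0 := (legendreSym.eq_zero_iff p _).2 (by simp)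
    rw [this]
    have key : ∀ b : ℕ, p ∣ b ^ 2 + b + k → p ∣ 2 * b + 1 := by
      intro b hb
      refine hℓ.dvd_of_dvd_pow (n := 2) ?_
      have := (Nat.dvd_sub (hb.mul_left 4) (dvd_refl p))
      convert this using 1
      have : 4 * (b ^ 2 + b + k) = (2 * b + 1) ^ 2 + p := by linarith
      omega
    cases j with
    | zero =>
      have : quadRoots k (p ^ (0 + 1)) = {p / 2} := by
        ext b
        simp only [quadRoots, zero_add, pow_one, Finset.mem_filter, Finset.mem_range,
          Finset.mem_singleton]
        constructor
        · rintro ⟨hb, hd⟩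
          obtain ⟨c, hc⟩ := key b hd
          have : c = 1 := by
            have : c < 2 := by
              by_contra h
              nlinarith
            interval_cases c <;> omega
          subst this
          omega
        · intro hb
          refine ⟨by omega, ?_⟩
          have h2 : 2 * b + 1 = p := by omega
          refine Nat.Coprime.dvd_of_dvd_mul_left (m := 4) ?_ ?_
          · exact Nat.Coprime.pow_right 2 (Nat.coprime_two_right.2 (Nat.odd_iff.2 (by omega)))
          · refine ⟨p + 1, ?_⟩
            rw [← h2] at hk ⊢
            linarith
      rw [this]
      simp
    | succ j =>
      have : (quadRoots k (p ^ (j + 1 + 1))).card = 0 := by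
        simp only [quadRoots, Finset.card_eq_zero, Finset.filter_eq_empty_iff]
        intro b _ hb
        have h2 : p ^ 2 ∣ b ^ 2 + b + k := (pow_dvd_pow p (by omega)).trans hb
        obtain ⟨c, hc⟩ := key b ((dvd_pow_self p two_ne_zero).trans h2)
        have h3 : p ^ 2 ∣ p := by
          have h4 : p ^ 2 ∣ (2 * b + 1) ^ 2 := ⟨c ^ 2, by rw [hc]; ring⟩
          have := (Nat.dvd_sub (h2.mul_left 4) h4)
          convert this using 1
          have : 4 * (b ^ 2 + b + k) = (2 * b + 1) ^ 2 + p := by linarith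
          omega
        have := Nat.le_of_dvd hℓ.pos h3
        nlinarith [hℓ.two_le]
      simp [this]
  have := Fact.mk hp
  have h4 : ¬ (p : ℤ) ∣ 4 * k - 1 := by
    rw [hk', add_sub_cancel_right, Int.natCast_dvd_natCast, Nat.prime_dvd_prime_iff_eq hp hℓ]
    exact hpl
  have hne : ((-ℓ : ℤ) : ZMod p) ≠ 0 := by
    rw [Ne, ZMod.intCast_zmod_eq_zero_iff_dvd, dvd_neg]
    rwa [hk', add_sub_cancel_right] at h4
  have hrec := legendreSym_neg_of_mod_four_eq_three (ℓ := ℓ) (p := p) (by omega) hp2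
  have hp' : Prime (p : ℤ) := Nat.prime_iff_prime_int.1 hp
  by_cases hex : ∃ b : ℤ, (p : ℤ) ∣ b ^ 2 + b + k
  · obtain ⟨b, hb⟩ := hex
    have h1 : legendreSym p (-ℓ) = 1 := by
      rw [legendreSym.eq_one_iff p hne]
      refine ⟨((2 * b + 1 : ℤ) : ZMod p), ?_⟩
      rw [← Int.cast_mul, ← sub_eq_zero, ← Int.cast_sub, ZMod.intCast_zmod_eq_zero_iff_dvd]
      exact (hb.mul_left (-4)).trans (dvd_of_eq (by linear_combination -hk'))
    rw [card_quadRoots_pow_eq_two hp h4 hb, ← hrec, h1]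
    norm_num
  · push Not at hex
    have h1 : legendreSym p (-ℓ) = -1 := by
      rw [legendreSym.eq_neg_one_iff]
      rintro ⟨y, hy⟩
      obtain ⟨y, rfl⟩ := ZMod.intCast_surjective y
      rw [← Int.cast_mul, ← sub_eq_zero, ← Int.cast_sub, ZMod.intCast_zmod_eq_zero_iff_dvd] at hy
      have hc : IsCoprime (p : ℤ) 2 := by
        rw [Prime.coprime_iff_not_dvd hp']
        intro h
        have : p ∣ 2 := by exact_mod_cast h
        exact hp2 ((Nat.prime_dvd_prime_iff_eq hp Nat.prime_two).1 this)
      obtain ⟨u, v, huv⟩ := hc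
      refine hex (v * (y - 1)) ?_
      refine IsCoprime.dvd_of_dvd_mul_left (y := 4) ?_ ?_
      · have : IsCoprime (p : ℤ) (2 ^ 2) := IsCoprime.pow_right ⟨u, v, huv⟩
        norm_num at this
        exact this
      · have h5 : 4 * ((v * (y - 1)) ^ 2 + v * (y - 1) + k) =
            -(-(ℓ : ℤ) - y * y) + p * (u * (y - 1)) * (p * (u * (y - 1)) - 2 * (y - 1) - 2) := by
          have : 2 * v = 1 - u * p := by linarith
          linear_combination hk' + (y - 1) * ((y - 1) * (2 * v + 1 - u * p) + 2) * this
        rw [h5]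
        exact (hy.neg_right).add (Dvd.intro _ (by ring : (p : ℤ) * ((u * (y - 1)) *
          (p * (u * (y - 1)) - 2 * (y - 1) - 2)) = _))
    rw [card_quadRoots_pow_eq_zero hex, ← hrec, h1]
    simp

/-- The number of residues `b` modulo `m` with `b² + b + k ≡ 0`, as an arithmetic function. -/
def quadRootCount (k : ℕ) : ArithmeticFunction ℤ :=
  ⟨fun m => (quadRoots k m).card, by simp [quadRoots]⟩

/-- The indicator function of the positive squares, as an arithmetic function. -/
def squareIndicator : ArithmeticFunction ℤ :=
  ⟨fun m => if m ≠ 0 ∧ IsSquare m then 1 else 0, by simp⟩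

/-- The Legendre symbol modulo `ℓ`, as an arithmetic function. -/
def legendreArith (ℓ : ℕ) [Fact ℓ.Prime] : ArithmeticFunction ℤ :=
  ⟨fun m => legendreSym ℓ m, by simp⟩

theorem isMultiplicative_quadRootCount (k : ℕ) : (quadRootCount k).IsMultiplicative := by
  rw [ArithmeticFunction.IsMultiplicative.iff_ne_zero]
  refine ⟨?_, fun {m n} hm hn h => ?_⟩
  · simp [quadRootCount, card_quadRoots_one]
  · simp [quadRootCount, card_quadRoots_mul k hm hn h]

theorem isMultiplicative_squareIndicator : squareIndicator.IsMultiplicative := by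
  rw [ArithmeticFunction.IsMultiplicative.iff_ne_zero]
  refine ⟨by simp [squareIndicator], fun {m n} hm hn h => ?_⟩
  have : IsSquare (m * n) ↔ IsSquare m ∧ IsSquare n := by
    refine ⟨fun ⟨a, ha⟩ => ?_, fun hs => hs.1.mul hs.2⟩
    rw [← sq] at ha
    obtain ⟨d, hd⟩ := exists_eq_pow_of_mul_eq_pow (Nat.isUnit_iff.2 h) ha
    obtain ⟨e, he⟩ := exists_eq_pow_of_mul_eq_pow (Nat.isUnit_iff.2 h.symm)
      ((mul_comm n m).trans ha)
    exact ⟨⟨d, hd.trans (sq d)⟩, ⟨e, he.trans (sq e)⟩⟩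
  simp only [squareIndicator, ArithmeticFunction.coe_mk, this]
  by_cases h1 : IsSquare m <;> by_cases h2 : IsSquare n <;> simp [h1, h2, hm, hn]

theorem isMultiplicative_legendreArith (ℓ : ℕ) [Fact ℓ.Prime] :
    (legendreArith ℓ).IsMultiplicative := by
  refine ⟨?_, fun {m n} _ => ?_⟩
  · simp [legendreArith]
  · simp [legendreArith, legendreSym.mul]

theorem isSquare_prime_pow_iff {p : ℕ} (hp : p.Prime) (i : ℕ) : IsSquare (p ^ i) ↔ Even i := by
  refine ⟨fun ⟨a, ha⟩ => ?_, fun h => h.isSquare_pow p⟩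
  have := congrArg (fun n => n.factorization p) ha
  have ha0 : a ≠ 0 := by
    rintro rfl
    exact pow_ne_zero i hp.ne_zero (by simpa using ha)
  simp [hp.factorization_self, Nat.factorization_mul ha0 ha0] at this
  exact ⟨_, this⟩

theorem sum_even_mul_eq_sum_pow {ρ : ℕ → ℤ} {c : ℤ} (h0 : ρ 0 = 1)
    (h1 : ∀ j, ρ (j + 1) = c ^ j * (1 + c)) (n : ℕ) :
    ∑ i ∈ Finset.range (n + 1), (if Even i then 1 else 0) * ρ (n - i) =
      ∑ i ∈ Finset.range (n + 1), c ^ i := by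
  induction n using Nat.twoStepInduction with
  | zero => rw [Finset.sum_range_one, Finset.sum_range_one]; simp [h0]
  | one => simp [Finset.sum_range_succ, h1 0]
  | more n ih _ =>
    rw [Finset.sum_range_succ', Finset.sum_range_succ', Finset.sum_range_succ (fun i => c ^ i),
      Finset.sum_range_succ (fun i => c ^ i), ← ih]
    have : ∀ i, Even (i + 1 + 1) ↔ Even i := fun i => by simp [Nat.even_add_one]
    simp only [this, Nat.add_sub_add_right]
    simp [h1]
    ring

theorem squareIndicator_mul_quadRootCount {ℓ k : ℕ} [Fact ℓ.Prime] (h8 : ℓ % 8 = 3)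
    (hk : 4 * k = ℓ + 1) :
    squareIndicator * quadRootCount k = ArithmeticFunction.zeta * legendreArith ℓ := by
  rw [ArithmeticFunction.IsMultiplicative.eq_iff_eq_on_prime_powers _
    (isMultiplicative_squareIndicator.mul (isMultiplicative_quadRootCount k)) _
    (ArithmeticFunction.isMultiplicative_zeta.natCast.mul (isMultiplicative_legendreArith ℓ))]
  intro p n hp
  rw [ArithmeticFunction.coe_zeta_mul_apply, ArithmeticFunction.mul_apply,
    Nat.sum_divisorsAntidiagonal (fun a b => squareIndicator a * quadRootCount k b),
    Nat.sum_divisors_prime_pow hp, Nat.sum_divisors_prime_pow hp]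
  have h := sum_even_mul_eq_sum_pow (ρ := fun j => quadRootCount k (p ^ j))
    (c := legendreSym ℓ p) (by simp [quadRootCount, card_quadRoots_one])
    (fun j => card_quadRoots_prime_pow h8 hk hp j) n
  convert h using 1
  · refine Finset.sum_congr rfl fun i hi => ?_
    rw [Nat.pow_div (by simpa [Nat.lt_succ_iff] using hi) hp.pos]
    simp [squareIndicator, isSquare_prime_pow_iff hp, hp.ne_zero]
  · refine Finset.sum_congr rfl fun i _ => ?_
    simp only [legendreArith, ArithmeticFunction.coe_mk, Nat.cast_pow]
    exact map_pow (legendreSym.hom ℓ) _ _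

theorem ncard_sectorReps_eq_sum_legendreSym {ℓ m : ℕ} [Fact ℓ.Prime] (h8 : ℓ % 8 = 3)
    (hm : 0 < m) : ((sectorReps ℓ m).ncard : ℤ) = ∑ d ∈ m.divisors, legendreSym ℓ d := by
  obtain ⟨k, hk⟩ : ∃ k, 4 * k = ℓ + 1 := ⟨(ℓ + 1) / 4, by omega⟩
  have h := congrArg (fun f => f m) (squareIndicator_mul_quadRootCount h8 hk)
  rw [ArithmeticFunction.coe_zeta_mul_apply, ArithmeticFunction.mul_apply] at h
  rw [ncard_sectorReps _ _ (by omega), ncard_axisReps hk hm]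
  refine Eq.trans ?_ h
  push_cast
  rw [Finset.sum_filter]
  refine Finset.sum_congr rfl fun p hp => ?_
  have : p.1 ≠ 0 := (Nat.ne_zero_of_mem_divisorsAntidiagonal hp).1
  simp [squareIndicator, quadRootCount, this]

open Real in
/-- The Gaussian sum `∑ exp (-c (n + α)²)` over the integers. -/
noncomputable def gaussianSum (c α : ℝ) : ℝ := ∑' n : ℤ, exp (-c * (n + α) ^ 2)

section Gaussian

open Real

theorem summable_gaussianSum {c : ℝ} (hc : 0 < c) (α : ℝ) :
    Summable fun n : ℤ => exp (-c * (n + α) ^ 2) := by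
  have h := (hasSum_jacobiTheta₂_term (Complex.I * (c * α / π : ℝ)) (τ := Complex.I * (c / π : ℝ))
    (by simp only [Complex.I_mul_im, Complex.ofReal_re]; positivity)).summable.norm.mul_left
      (exp (-c * α ^ 2))
  refine h.congr fun n => ?_
  rw [jacobiTheta₂_term, Complex.norm_exp, ← exp_add]
  congr 1
  have : 2 * (π : ℂ) * Complex.I * n * (Complex.I * (c * α / π : ℝ)) +
      π * Complex.I * n ^ 2 * (Complex.I * (c / π : ℝ)) =
      ((-(2 * π * n * (c * α / π)) - π * n ^ 2 * (c / π) : ℝ) : ℂ) := by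
    push_cast
    linear_combination (2 * (π : ℂ) * n * (c * α / π) + π * n ^ 2 * (c / π)) * Complex.I_sq
  rw [this, Complex.ofReal_re]
  field_simp
  ring

theorem tsum_exp_neg_sub_one_le {a : ℝ} (ha : 0 < a) :
    (∑' n : ℤ, exp (-π * a * (n : ℝ) ^ 2)) - 1 ≤ 2 / (1 - exp (-π * a)) * exp (-π * a) := by
  have h := norm_jacobiTheta_sub_one_le (τ := Complex.I * a) (by simpa using ha)
  have h1 : jacobiTheta (Complex.I * a) = ((∑' n : ℤ, exp (-π * a * (n : ℝ) ^ 2) : ℝ) : ℂ) := by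
    rw [jacobiTheta, Complex.ofReal_tsum]
    refine tsum_congr fun n => ?_
    push_cast
    congr 1
    linear_combination ((π : ℂ) * n ^ 2 * a) * Complex.I_sq
  rw [h1, ← Complex.ofReal_one, ← Complex.ofReal_sub, Complex.norm_real] at h
  simpa using (le_abs_self _).trans h

theorem gaussianSum_eq {c : ℝ} (hc : 0 < c) (α : ℝ) :
    (gaussianSum c α : ℂ) = √(π / c) *
      ∑' n : ℤ, Complex.exp (-π * (π / c : ℝ) * n ^ 2 + 2 * π * (-(Complex.I * α)) * n) := by
  have hpc : 0 < π / c := by positivity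
  have h := Complex.tsum_exp_neg_quadratic (a := ((π / c : ℝ) : ℂ)) (by simpa using hpc)
    (-(Complex.I * α))
  have h2 : ((π / c : ℝ) : ℂ) ^ (1 / 2 : ℂ) = ((√(π / c) : ℝ) : ℂ) := by
    rw [sqrt_eq_rpow, Complex.ofReal_cpow hpc.le]
    norm_num
  have h3 : ((√(π / c) : ℝ) : ℂ) ≠ 0 := by
    exact_mod_cast (sqrt_pos.2 hpc).ne'
  rw [h, h2, ← mul_assoc, mul_one_div_cancel h3, one_mul, gaussianSum, Complex.ofReal_tsum]
  refine tsum_congr fun n => ?_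
  push_cast
  congr 1
  have hc' : (c : ℂ) ≠ 0 := by exact_mod_cast hc.ne'
  have hp' : (π : ℂ) ≠ 0 := by exact_mod_cast pi_ne_zero
  have : (n : ℂ) + Complex.I * -(Complex.I * α) = n + α := by
    linear_combination (-α : ℂ) * Complex.I_sq
  rw [this]
  field_simp

theorem abs_gaussianSum_sub_le {c : ℝ} (hc : 0 < c) (hc1 : c ≤ 1) (α : ℝ) :
    |gaussianSum c α - √(π / c)| ≤ c ^ 2 := by
  set a : ℝ := π / c with ha_def
  have ha : 0 < a := by positivity
  set f : ℤ → ℂ := fun n => Complex.exp (-π * a * n ^ 2 + 2 * π * (-(Complex.I * α)) * n) with hf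
  have hnorm (n : ℤ) : ‖f n‖ = exp (-π * a * (n : ℝ) ^ 2) := by
    rw [hf, Complex.norm_exp]
    congr 1
    have : -(π : ℂ) * a * n ^ 2 + 2 * π * (-(Complex.I * α)) * n =
      ((-π * a * n ^ 2 : ℝ) : ℂ) + ((-(2 * π * α * n) : ℝ) : ℂ) * Complex.I := by
      push_cast; ring
    rw [this]
    simp only [Complex.add_re, Complex.ofReal_re, Complex.re_ofReal_mul, Complex.I_re]
    ring
  have hsn : Summable fun n => ‖f n‖ := by
    refine (summable_gaussianSum (c := π * a) (by positivity) 0).congr fun n => ?_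
    rw [hnorm]
    simp
  have hs : Summable f := hsn.of_norm
  have hf0 : f 0 = 1 := by simp [hf]
  have h1 : ‖(∑' n, f n) - 1‖ ≤ (∑' n : ℤ, exp (-π * a * (n : ℝ) ^ 2)) - 1 := by
    have e1 := hs.tsum_eq_add_tsum_ite 0
    have e2 := hsn.tsum_eq_add_tsum_ite 0
    rw [hf0] at e1
    simp only [hf0, norm_one] at e2
    rw [e1, ← tsum_congr hnorm, e2, add_sub_cancel_left, add_sub_cancel_left]
    have e3 : (fun n : ℤ => if n = 0 then (0 : ℝ) else ‖f n‖) =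
        fun n => ‖if n = 0 then (0 : ℂ) else f n‖ := by
      ext n; split_ifs <;> simp
    rw [e3]
    apply norm_tsum_le_tsum_norm
    rw [← e3]
    refine Summable.of_nonneg_of_le (fun n => ?_) (fun n => ?_) hsn
    · split_ifs <;> positivity
    · split_ifs
      · positivity
      · exact le_rfl
  have h2 := h1.trans (tsum_exp_neg_sub_one_le ha)
  have h3 : |gaussianSum c α - √a| = √a * ‖(∑' n, f n) - 1‖ := by
    rw [← Real.norm_eq_abs, ← Complex.norm_real, Complex.ofReal_sub, gaussianSum_eq hc α]
    rw [← ha_def, ← mul_sub_one, norm_mul, Complex.norm_real, Real.norm_eq_abs,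
      abs_of_nonneg (sqrt_nonneg _)]
  have h4 : √a ≤ 2 / c := by
    rw [sqrt_le_left (by positivity), ha_def, div_pow, div_le_div_iff₀ hc (by positivity)]
    have := pi_le_four
    nlinarith [mul_pos hc hc, mul_nonneg hc.le (sub_nonneg.2 hc1), mul_pos hc pi_pos]
  have h5 : exp (-π * a) ≤ c ^ 3 / 64 := by
    have hz : 9 / c ≤ π * a := by
      rw [ha_def, mul_div_assoc', div_le_div_iff_of_pos_right hc]
      nlinarith [pi_gt_three]
    have hz0 : 0 < 9 / c := by positivity
    have e := pow_div_factorial_le_exp (9 / c) hz0.le 3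
    have e' : (9 / c) ^ 3 / (Nat.factorial 3 : ℝ) = (243 / 2) / c ^ 3 := by
      norm_num [Nat.factorial, div_pow]; ring
    have h : (64 : ℝ) / c ^ 3 ≤ exp (π * a) := by
      refine le_trans ?_ (e.trans (exp_le_exp.2 hz))
      rw [e']
      gcongr
      norm_num
    rw [neg_mul, exp_neg, inv_le_comm₀ (exp_pos _) (by positivity), inv_div]
    exact h
  have hq : 0 < exp (-π * a) := exp_pos _
  have hc3 : c ^ 3 ≤ 1 := pow_le_one₀ hc.le hc1
  have h6 : 2 / (1 - exp (-π * a)) * exp (-π * a) ≤ 4 * (c ^ 3 / 64) := by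
    have : 2 / (1 - exp (-π * a)) ≤ 4 := by
      rw [div_le_iff₀ (by linarith)]; linarith
    gcongr
  rw [h3]
  calc √a * ‖(∑' n, f n) - 1‖ ≤ 2 / c * (4 * (c ^ 3 / 64)) := by
        gcongr
        exact h2.trans h6
    _ = c ^ 2 / 8 := by field_simp; ring
    _ ≤ c ^ 2 := by nlinarith [sq_nonneg c]

end Gaussian

section Theta

open Real Filter Topology

/-- The quadratic form `r (x + y)² + s x² + t y²`. -/
def sectorForm (q : ℤ × ℤ × ℤ) (v : ℤ × ℤ) : ℤ :=
  q.1 * (v.1 + v.2) ^ 2 + q.2.1 * v.1 ^ 2 + q.2.2 * v.2 ^ 2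

theorem summable_exp_neg_sectorForm {q : ℤ × ℤ × ℤ} (hr : 0 < q.1) (hs : 0 < q.2.1)
    (ht : 0 < q.2.2) {u : ℝ} (hu : 0 < u) :
    Summable fun v : ℤ × ℤ => exp (-u * sectorForm q v) := by
  have h := summable_gaussianSum hu 0
  refine Summable.of_nonneg_of_le (fun v => (exp_pos _).le) (fun v => ?_)
    (h.mul_of_nonneg h (fun n => (exp_pos _).le) (fun n => (exp_pos _).le))
  rw [← exp_add, exp_le_exp]
  have hZ : v.1 ^ 2 + v.2 ^ 2 ≤ sectorForm q v := by
    rw [sectorForm]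
    nlinarith [mul_nonneg hr.le (sq_nonneg (v.1 + v.2)), mul_nonneg (Int.sub_nonneg.2 hs)
      (sq_nonneg v.1), mul_nonneg (Int.sub_nonneg.2 ht) (sq_nonneg v.2)]
  have hR : (v.1 : ℝ) ^ 2 + (v.2 : ℝ) ^ 2 ≤ sectorForm q v := by exact_mod_cast hZ
  nlinarith

theorem tsum_exp_neg_sectorForm {q : ℤ × ℤ × ℤ} (hr : 0 < q.1) (hs : 0 < q.2.1)
    (ht : 0 < q.2.2) {ℓ : ℕ} (hℓ : q.1 * q.2.1 + q.2.1 * q.2.2 + q.2.2 * q.1 = ℓ) {u : ℝ}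
    (hu : 0 < u) :
    ∑' v : ℤ × ℤ, exp (-u * sectorForm q v) =
      ∑' x : ℤ, exp (-(u * ℓ / (q.1 + q.2.2)) * ((x : ℝ) + 0) ^ 2) *
        gaussianSum (u * (q.1 + q.2.2)) (q.1 * x / (q.1 + q.2.2)) := by
  rw [(summable_exp_neg_sectorForm hr hs ht hu).tsum_prod]
  refine tsum_congr fun x => ?_
  rw [gaussianSum, ← tsum_mul_left]
  refine tsum_congr fun y => ?_
  rw [← exp_add]
  congr 1
  have hA : (0 : ℝ) < q.1 + q.2.2 := by exact_mod_cast add_pos hr ht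
  have hℓ' : (ℓ : ℝ) = q.1 * q.2.1 + q.2.1 * q.2.2 + q.2.2 * q.1 := by exact_mod_cast hℓ.symm
  rw [hℓ', sectorForm]
  push_cast
  field_simp
  ring

theorem abs_tsum_exp_neg_sectorForm_sub_le {q : ℤ × ℤ × ℤ} (hr : 0 < q.1) (hs : 0 < q.2.1)
    (ht : 0 < q.2.2) {ℓ : ℕ} (hℓ : q.1 * q.2.1 + q.2.1 * q.2.2 + q.2.2 * q.1 = ℓ) {A u : ℝ}
    (hA' : A = q.1 + q.2.2) (hu : 0 < u) (huA : u * A ≤ 1) (huℓ : u * ℓ / A ≤ 1) :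
    |∑' v : ℤ × ℤ, exp (-u * sectorForm q v) - π / (√ℓ * u)| ≤
      (u * A) ^ 2 * (√(π / (u * ℓ / A)) + (u * ℓ / A) ^ 2) +
        √(π / (u * A)) * (u * ℓ / A) ^ 2 := by
  have hA : (0 : ℝ) < A := by rw [hA']; exact_mod_cast add_pos hr ht
  have hℓ0 : (0 : ℝ) < ℓ := by
    have : (0 : ℤ) < ℓ := by rw [← hℓ]; positivity
    exact_mod_cast this
  set c := u * ℓ / A with hc
  have hc0 : 0 < c := by positivity
  set W := gaussianSum c 0 with hW
  set E : ℤ → ℝ := fun x => exp (-c * ((x : ℝ) + 0) ^ 2) with hE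
  set G : ℤ → ℝ := fun x => gaussianSum (u * A) (q.1 * x / A) with hG
  have hθ : ∑' v : ℤ × ℤ, exp (-u * sectorForm q v) = ∑' x, E x * G x := by
    rw [tsum_exp_neg_sectorForm hr hs ht hℓ hu, ← hA']
  have hEs : Summable E := summable_gaussianSum hc0 0
  have hGb (x : ℤ) : |G x - √(π / (u * A))| ≤ (u * A) ^ 2 :=
    abs_gaussianSum_sub_le (by positivity) huA _
  have hbound (x : ℤ) : ‖E x * (G x - √(π / (u * A)))‖ ≤ E x * (u * A) ^ 2 := by
    rw [norm_mul, Real.norm_eq_abs, Real.norm_eq_abs, abs_of_pos (exp_pos _)]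
    exact mul_le_mul_of_nonneg_left (hGb x) (exp_pos _).le
  have hdiff : Summable fun x => E x * (G x - √(π / (u * A))) :=
    Summable.of_norm_bounded (hEs.mul_right _) hbound
  have h1 : ∑' x, E x * G x - W * √(π / (u * A)) = ∑' x, E x * (G x - √(π / (u * A))) := by
    have : ∑' x, E x * G x = ∑' x, (E x * (G x - √(π / (u * A))) + E x * √(π / (u * A))) :=
      tsum_congr fun x => by ring
    rw [this, hdiff.tsum_add (hEs.mul_right _), tsum_mul_right, hW, gaussianSum]
    ring
  have h2 : |∑' x, E x * G x - W * √(π / (u * A))| ≤ W * (u * A) ^ 2 := by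
    rw [h1, ← Real.norm_eq_abs, hW, gaussianSum, ← tsum_mul_right]
    exact tsum_of_norm_bounded (hEs.mul_right _).hasSum hbound
  have h3 : |W - √(π / c)| ≤ c ^ 2 := abs_gaussianSum_sub_le hc0 huℓ 0
  have h4 : √(π / c) * √(π / (u * A)) = π / (√ℓ * u) := by
    rw [← sqrt_mul (by positivity)]
    have : π / c * (π / (u * A)) = (π / (√ℓ * u)) ^ 2 := by
      rw [div_pow, mul_pow, sq_sqrt hℓ0.le, hc]
      field_simp
    rw [this, sqrt_sq (by positivity)]
  have h5 : W ≤ √(π / c) + c ^ 2 := by linarith [(abs_le.1 h3).2]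
  rw [hθ, ← h4]
  calc |∑' x, E x * G x - √(π / c) * √(π / (u * A))|
      = |(∑' x, E x * G x - W * √(π / (u * A))) + √(π / (u * A)) * (W - √(π / c))| := by
        congr 1; ring
    _ ≤ W * (u * A) ^ 2 + √(π / (u * A)) * |W - √(π / c)| := by
        refine (abs_add_le _ _).trans (add_le_add h2 ?_)
        rw [abs_mul, abs_of_nonneg (sqrt_nonneg _)]
    _ ≤ (u * A) ^ 2 * (√(π / c) + c ^ 2) + √(π / (u * A)) * c ^ 2 := by
        rw [mul_comm W]
        gcongr

theorem tendsto_tsum_exp_neg_sectorForm_sub {q : ℤ × ℤ × ℤ} (hr : 0 < q.1) (hs : 0 < q.2.1)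
    (ht : 0 < q.2.2) {ℓ : ℕ} (hℓ : q.1 * q.2.1 + q.2.1 * q.2.2 + q.2.2 * q.1 = ℓ) :
    Tendsto (fun u : ℝ => ∑' v : ℤ × ℤ, exp (-u * sectorForm q v) - π / (√ℓ * u))
      (𝓝[>] 0) (𝓝 0) := by
  obtain ⟨A, hA'⟩ : ∃ A : ℝ, A = q.1 + q.2.2 := ⟨_, rfl⟩
  have hA : (0 : ℝ) < A := by rw [hA']; exact_mod_cast add_pos hr ht
  have hℓ0 : (0 : ℝ) < ℓ := by
    have : (0 : ℤ) < ℓ := by rw [← hℓ]; positivity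
    exact_mod_cast this
  have hcont (f : ℝ → ℝ) (hf : Continuous f) (h0 : f 0 = 0) : Tendsto f (𝓝[>] 0) (𝓝 0) := by
    have := (hf.tendsto 0).mono_left (nhdsWithin_le_nhds (s := Set.Ioi 0))
    rwa [h0] at this
  have hlt (k : ℝ) : ∀ᶠ u : ℝ in 𝓝[>] 0, u * k < 1 :=
    (hcont (fun u => u * k) (by fun_prop) (by simp)).eventually_lt_const one_pos
  have key : Tendsto (fun u : ℝ => A ^ 2 * (u * √(π * A / ℓ * u) + (ℓ / A) ^ 2 * u ^ 4) +
      (ℓ / A) ^ 2 * (u * √(π / A * u))) (𝓝[>] 0) (𝓝 0) :=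
    hcont _ (by fun_prop) (by simp)
  refine squeeze_zero_norm' ?_ key
  filter_upwards [hlt A, hlt (ℓ / A), self_mem_nhdsWithin] with u h1 h2 hu
  have hu' : (0 : ℝ) < u := hu
  have hsq (k : ℝ) : u * √(k * u) = u ^ 2 * √(k / u) := by
    have : k * u = k / u * u ^ 2 := by field_simp
    rw [this, sqrt_mul' _ (sq_nonneg u), sqrt_sq hu'.le]
    ring
  rw [Real.norm_eq_abs, hsq, hsq]
  refine (abs_tsum_exp_neg_sectorForm_sub_le hr hs ht hℓ hA' hu' h1.le
    (by rw [mul_div_assoc]; exact h2.le)).trans (le_of_eq ?_)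
  have e1 : π / (u * ℓ / A) = π * A / ℓ / u := by field_simp
  have e2 : π / (u * A) = π / A / u := by field_simp
  rw [e1, e2]
  ring

end Theta

section Rotation

open Real

/-- The order-six rotation `((r, s, t), (x, y)) ↦ ((s, t, r), (-y, x + y))`, which preserves
`sectorForm`. -/
def sectorRotation (N : ℤ) : Equiv.Perm (oddSymmTriples N × (ℤ × ℤ)) where
  toFun p := (⟨(p.1.1.2.1, p.1.1.2.2, p.1.1.1), by
    obtain ⟨⟨q, h1, h2, h3, h4, h5, h6, h7⟩, v⟩ := p
    exact ⟨h3, h4, h5, h6, h1, h2, Eq.trans (by dsimp only; ring) h7⟩⟩, (-p.2.2, p.2.1 + p.2.2))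
  invFun p := (⟨(p.1.1.2.2, p.1.1.1, p.1.1.2.1), by
    obtain ⟨⟨q, h1, h2, h3, h4, h5, h6, h7⟩, v⟩ := p
    exact ⟨h5, h6, h1, h2, h3, h4, Eq.trans (by dsimp only; ring) h7⟩⟩, (p.2.1 + p.2.2, -p.2.1))
  left_inv p := by simp
  right_inv p := by simp

theorem sectorForm_sectorRotation {N : ℤ} (p : oddSymmTriples N × (ℤ × ℤ)) :
    sectorForm (sectorRotation N p).1 (sectorRotation N p).2 = sectorForm p.1 p.2 := by
  simp only [sectorRotation, sectorForm, Equiv.coe_fn_mk]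
  ring

theorem sectorForm_sectorRotation_pow {N : ℤ} (i : ℕ) (p : oddSymmTriples N × (ℤ × ℤ)) :
    sectorForm ((sectorRotation N ^ i) p).1 ((sectorRotation N ^ i) p).2 =
      sectorForm p.1 p.2 := by
  induction i with
  | zero => rfl
  | succ i ih => rw [pow_succ', Equiv.Perm.mul_apply, sectorForm_sectorRotation, ih]

/-- The contribution of a vector to the theta series, restricted to the sector `x > 0`, `y ≥ 0`. -/
noncomputable def sectorTerm (N : ℤ) (u : ℝ) (p : oddSymmTriples N × (ℤ × ℤ)) : ℝ :=
  if 0 < p.2.1 ∧ 0 ≤ p.2.2 then exp (-u * sectorForm p.1 p.2) else 0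

theorem sum_sectorTerm_sectorRotation {N : ℤ} (u : ℝ) (p : oddSymmTriples N × (ℤ × ℤ)) :
    ∑ i ∈ Finset.range 6, sectorTerm N u ((sectorRotation N ^ i) p) =
      if p.2 = 0 then 0 else exp (-u * sectorForm p.1 p.2) := by
  simp only [sectorTerm, sectorForm_sectorRotation_pow]
  obtain ⟨q, x, y⟩ := p
  simp only [Finset.sum_range_succ, Finset.sum_range_zero, zero_add, pow_succ, pow_zero, one_mul,
    Equiv.Perm.mul_apply, Equiv.Perm.one_apply, sectorRotation, Equiv.coe_fn_mk,
    Prod.mk_eq_zero]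
  generalize exp _ = E
  by_cases h0 : x = 0 ∧ y = 0
  · obtain ⟨rfl, rfl⟩ := h0
    simp
  rw [if_neg h0]
  by_cases h1 : 0 < x ∧ 0 ≤ y
  · rw [if_pos h1]; repeat rw [if_neg (by omega)]
    simp
  by_cases h2 : 0 < -y ∧ 0 ≤ x + y
  · rw [if_neg h1, if_pos h2]; repeat rw [if_neg (by omega)]
    simp
  by_cases h3 : 0 < -(x + y) ∧ 0 ≤ x
  · rw [if_neg h1, if_neg h2, if_pos (by omega)]; repeat rw [if_neg (by omega)]
    simp
  by_cases h4 : 0 < -x ∧ 0 ≤ -y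
  · rw [if_neg h1, if_neg h2, if_neg (by omega), if_pos (by omega)]; repeat rw [if_neg (by omega)]
    simp
  by_cases h5 : 0 < y ∧ 0 ≤ -(x + y)
  · rw [if_neg h1, if_neg h2, if_neg (by omega), if_neg (by omega), if_pos (by omega),
      if_neg (by omega)]
    simp
  · rw [if_neg h1, if_neg h2, if_neg (by omega), if_neg (by omega), if_neg (by omega),
      if_pos (by omega)]
    simp

instance (N : ℤ) : Finite (oddSymmTriples N) := (finite_oddSymmTriples N).to_subtype

theorem summable_exp_neg_sectorForm_prod (N : ℤ) {u : ℝ} (hu : 0 < u) :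
    Summable fun p : oddSymmTriples N × (ℤ × ℤ) => exp (-u * sectorForm p.1 p.2) := by
  refine (summable_prod_of_nonneg fun p => (exp_pos _).le).2 ⟨fun q => ?_, .of_finite⟩
  exact summable_exp_neg_sectorForm q.2.1 q.2.2.2.1 q.2.2.2.2.2.1 hu

theorem summable_sectorTerm (N : ℤ) {u : ℝ} (hu : 0 < u) : Summable (sectorTerm N u) := by
  refine Summable.of_nonneg_of_le (fun p => ?_) (fun p => ?_)
    (summable_exp_neg_sectorForm_prod N hu)
  · rw [sectorTerm]; split_ifs <;> positivity
  · rw [sectorTerm]; split_ifs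
    · exact le_rfl
    · positivity

theorem tsum_sub_one_eq_tsum_sectorTerm (N : ℤ) {u : ℝ} (hu : 0 < u) :
    ∑' q : oddSymmTriples N, (∑' v : ℤ × ℤ, exp (-u * sectorForm q v) - 1) =
      6 * ∑' p, sectorTerm N u p := by
  have hs (i : ℕ) : Summable fun p => sectorTerm N u ((sectorRotation N ^ i) p) :=
    (summable_sectorTerm N hu).comp_injective (sectorRotation N ^ i).injective
  have h1 : ∑' p : oddSymmTriples N × (ℤ × ℤ),
      (if p.2 = 0 then 0 else exp (-u * sectorForm p.1 p.2)) = 6 * ∑' p, sectorTerm N u p := by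
    simp_rw [← sum_sectorTerm_sectorRotation]
    rw [Summable.tsum_finsetSum fun i _ => hs i]
    simp_rw [(sectorRotation N ^ _).tsum_eq (sectorTerm N u)]
    simp
  rw [← h1, Summable.tsum_prod]
  · refine tsum_congr fun q => ?_
    rw [(summable_exp_neg_sectorForm q.2.1 q.2.2.2.1 q.2.2.2.2.2.1 hu).tsum_eq_add_tsum_ite 0]
    simp [sectorForm]
  · simp_rw [← sum_sectorTerm_sectorRotation]
    exact summable_sum fun i _ => hs i

/-- The inclusion of all sets `sectorReps N m` into the pairs of a triple and a vector. -/
def sectorRepsInclusion (N : ℤ) (a : Σ m : ℕ, sectorReps N m) : oddSymmTriples N × (ℤ × ℤ) :=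
  (⟨(a.2.1.1, a.2.1.2.1, a.2.1.2.2.1), by
    obtain ⟨m, q, h1, h2, h3, h4, h5, h6, h7, -⟩ := a
    exact ⟨h1, h2, h3, h4, h5, h6, h7⟩⟩, (a.2.1.2.2.2.1, a.2.1.2.2.2.2))

theorem sectorRepsInclusion_injective (N : ℤ) : Function.Injective (sectorRepsInclusion N) := by
  rintro ⟨m, ⟨⟨r, s, t, x, y⟩, h⟩⟩ ⟨m', ⟨⟨r', s', t', x', y'⟩, h'⟩⟩ e
  simp only [sectorRepsInclusion, Prod.mk.injEq, Subtype.mk.injEq] at e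
  obtain ⟨⟨rfl, rfl, rfl⟩, rfl, rfl⟩ := e
  have e1 := h.2.2.2.2.2.2.2.2.2
  have e2 := h'.2.2.2.2.2.2.2.2.2
  have : m = m' := by omega
  subst this
  rfl

theorem support_sectorTerm_subset (N : ℤ) (u : ℝ) :
    Function.support (sectorTerm N u) ⊆ Set.range (sectorRepsInclusion N) := by
  rintro ⟨⟨⟨r, s, t⟩, h1, h2, h3, h4, h5, h6, h7⟩, x, y⟩ hp
  rw [Function.mem_support, sectorTerm, ite_ne_right_iff] at hp
  obtain ⟨⟨hx, hy⟩, -⟩ := hp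
  dsimp only at *
  have hpar : Even (r * (x + y) ^ 2 + s * x ^ 2 + t * y ^ 2) := by
    rw [← Int.odd_iff] at h2 h4 h6
    have : ¬ Even r ∧ ¬ Even s ∧ ¬ Even t := by
      simpa only [Int.not_even_iff_odd] using ⟨h2, h4, h6⟩
    simp only [Int.even_add, Int.even_mul, Int.even_pow, this]
    tauto
  have hpos : 0 ≤ r * (x + y) ^ 2 + s * x ^ 2 + t * y ^ 2 := by positivity
  obtain ⟨m, hm⟩ := hpar
  obtain ⟨n, rfl⟩ := Int.eq_ofNat_of_zero_le (by omega : 0 ≤ m)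
  exact ⟨⟨n, ⟨(r, s, t, x, y), h1, h2, h3, h4, h5, h6, h7, hx, hy, by rw [hm]; ring⟩⟩, rfl⟩

theorem sectorTerm_sectorRepsInclusion {N : ℤ} (u : ℝ) (a : Σ m : ℕ, sectorReps N m) :
    sectorTerm N u (sectorRepsInclusion N a) = exp (-(2 * u) * a.1) := by
  obtain ⟨m, ⟨⟨r, s, t, x, y⟩, h⟩⟩ := a
  have hx := h.2.2.2.2.2.2.2.1
  have hy := h.2.2.2.2.2.2.2.2.1
  have e := h.2.2.2.2.2.2.2.2.2
  rw [sectorTerm, if_pos ⟨hx, hy⟩]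
  simp only [sectorRepsInclusion, sectorForm]
  dsimp only at e
  rw [e]
  push_cast
  ring_nf

theorem tsum_sub_one_eq_tsum_ncard_sectorReps (N : ℤ) {u : ℝ} (hu : 0 < u) :
    ∑' q : oddSymmTriples N, (∑' v : ℤ × ℤ, exp (-u * sectorForm q v) - 1) =
      6 * ∑' m : ℕ, (sectorReps N m).ncard * exp (-(2 * u) * m) := by
  have hinj := sectorRepsInclusion_injective N
  have hs : Summable fun a => sectorTerm N u (sectorRepsInclusion N a) :=
    (summable_sectorTerm N hu).comp_injective hinj
  rw [tsum_sub_one_eq_tsum_sectorTerm N hu, ← hinj.tsum_eq (support_sectorTerm_subset N u),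
    hs.tsum_sigma]
  simp_rw [sectorTerm_sectorRepsInclusion, tsum_const, Nat.card_coe_set_eq, nsmul_eq_mul]

end Rotation

section Lambert

open Real Filter Topology

theorem summable_mul_pow_mul {f : ℕ → ℝ} (hf : ∀ n, |f n| ≤ 1) {r : ℝ} (hr0 : 0 < r)
    (hr1 : r < 1) : Summable fun c : ℕ+ × ℕ+ => f c.1 * r ^ (c.1 * c.2 : ℕ) := by
  have h := summable_prod_mul_pow 0 (r := r) (by rwa [Real.norm_eq_abs, abs_of_pos hr0])
  refine Summable.of_norm_bounded h fun c => ?_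
  rw [norm_mul, Real.norm_eq_abs, Real.norm_eq_abs, abs_of_pos (pow_pos hr0 _), pow_zero]
  exact mul_le_mul_of_nonneg_right (hf _) (pow_pos hr0 _).le

theorem hasSum_pnat_pow {x : ℝ} (h0 : 0 ≤ x) (h1 : x < 1) :
    HasSum (fun n : ℕ+ => x ^ (n : ℕ)) (x / (1 - x)) := by
  rw [← Equiv.pnatEquivNat.symm.hasSum_iff]
  convert! (hasSum_geometric_of_lt_one h0 h1).mul_left x using 1
  ext n
  simp [pow_succ']

theorem hasSum_mul_pow_div {f : ℕ → ℝ} (hf : ∀ n, |f n| ≤ 1) {r : ℝ} (hr0 : 0 < r)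
    (hr1 : r < 1) :
    HasSum (fun d : ℕ+ => f d * (r ^ (d : ℕ) / (1 - r ^ (d : ℕ))))
      (∑' c : ℕ+ × ℕ+, f c.1 * r ^ (c.1 * c.2 : ℕ)) := by
  refine (summable_mul_pow_mul hf hr0 hr1).hasSum.prod_fiberwise fun d => ?_
  have h := (hasSum_pnat_pow (pow_pos hr0 (d : ℕ)).le
    (pow_lt_one₀ hr0.le hr1 d.ne_zero)).mul_left (f d)
  simpa only [← pow_mul] using h

theorem tsum_sum_divisors_mul_pow {f : ℕ → ℝ} (hf : ∀ n, |f n| ≤ 1) {r : ℝ} (hr0 : 0 < r)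
    (hr1 : r < 1) :
    ∑' m : ℕ, (∑ d ∈ m.divisors, f d) * r ^ m =
      ∑' c : ℕ+ × ℕ+, f c.1 * r ^ (c.1 * c.2 : ℕ) := by
  have hs : Summable fun c => f (sigmaAntidiagonalEquivProd c).1 *
      r ^ ((sigmaAntidiagonalEquivProd c).1 * (sigmaAntidiagonalEquivProd c).2 : ℕ) :=
    (summable_mul_pow_mul hf hr0 hr1).comp_injective sigmaAntidiagonalEquivProd.injective
  rw [← sigmaAntidiagonalEquivProd.tsum_eq, hs.tsum_sigma,
    ← PNat.coe_injective.tsum_eq (f := fun m : ℕ => (∑ d ∈ m.divisors, f d) * r ^ m)]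
  · refine tsum_congr fun n => ?_
    simp only [tsum_fintype, sigmaAntidiagonalEquivProd, divisorsAntidiagonalFactors,
      Equiv.coe_fn_mk, PNat.mk_coe, Finset.univ_eq_attach]
    rw [(n : ℕ).divisorsAntidiagonal.sum_attach fun x : ℕ × ℕ => f x.1 * r ^ (x.1 * x.2),
      Nat.sum_divisorsAntidiagonal fun x y => f x * r ^ (x * y), Finset.sum_mul]
    refine Finset.sum_congr rfl fun d hd => ?_
    rw [Nat.mul_div_cancel' (Nat.dvd_of_mem_divisors hd)]
  · intro m hm
    refine ⟨⟨m, Nat.pos_of_ne_zero ?_⟩, rfl⟩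
    rintro rfl
    simp at hm

/-- The logistic function `1 / (1 + exp v)`. -/
noncomputable def expRecip (v : ℝ) : ℝ := 1 / (1 + exp v)

theorem expRecip_nonneg (v : ℝ) : 0 ≤ expRecip v := by
  rw [expRecip]; positivity

theorem expRecip_le (v : ℝ) : expRecip v ≤ exp (-v) := by
  rw [expRecip, exp_neg, one_div]
  exact inv_anti₀ (exp_pos _) (by linarith)

theorem tsum_lambert_sub {f : ℕ → ℝ} (hf : ∀ n, |f n| ≤ 1) (hf0 : f 0 = 0) {τ : ℝ}
    (hτ : 0 < τ) :
    ∑' m : ℕ, (∑ d ∈ m.divisors, f d) * exp (-τ * m) -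
      2 * ∑' m : ℕ, (∑ d ∈ m.divisors, f d) * exp (-(2 * τ) * m) =
      ∑' d : ℕ, f d * expRecip (τ * d) := by
  have key {σ : ℝ} (hσ : 0 < σ) : HasSum (fun d : ℕ+ => f d * (exp (-σ) ^ (d : ℕ) /
      (1 - exp (-σ) ^ (d : ℕ)))) (∑' m : ℕ, (∑ d ∈ m.divisors, f d) * exp (-σ * m)) := by
    have h := hasSum_mul_pow_div hf (exp_pos (-σ)) (by simpa using hσ)
    rw [← tsum_sum_divisors_mul_pow hf (exp_pos (-σ)) (by simpa using hσ)] at h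
    convert! h using 4 with m
    rw [← exp_nat_mul]
    ring_nf
  have h := ((key hτ).sub ((key (by positivity : 0 < 2 * τ)).mul_left 2)).tsum_eq
  rw [← h, ← PNat.coe_injective.tsum_eq (f := fun d : ℕ => f d * expRecip (τ * d))]
  · refine tsum_congr fun d => ?_
    have e2 : exp (-(2 * τ)) ^ (d : ℕ) = (exp (-τ) ^ (d : ℕ)) ^ 2 := by
      rw [← exp_nat_mul, ← exp_nat_mul, ← exp_nat_mul]; push_cast; ring_nf
    have e1 : exp (τ * (d : ℕ)) = (exp (-τ) ^ (d : ℕ))⁻¹ := by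
      rw [← exp_nat_mul, ← exp_neg]; ring_nf
    have hx0 : 0 < exp (-τ) ^ (d : ℕ) := pow_pos (exp_pos _) _
    have hx1 : exp (-τ) ^ (d : ℕ) < 1 :=
      pow_lt_one₀ (exp_pos _).le (by simpa using hτ) d.ne_zero
    rw [expRecip, e1, e2]
    generalize exp (-τ) ^ (d : ℕ) = x at hx0 hx1
    have h1 : 1 - x ≠ 0 := by linarith
    have h2 : 1 + x ≠ 0 := by linarith
    have h3 : 1 - x ^ 2 = (1 - x) * (1 + x) := by ring
    have h4 : x + 1 ≠ 0 := by linarith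
    rw [h3]
    field_simp
    ring
  · intro m hm
    refine ⟨⟨m, Nat.pos_of_ne_zero ?_⟩, rfl⟩
    rintro rfl
    simp [hf0] at hm

theorem hasDerivAt_expRecip (v : ℝ) : HasDerivAt expRecip (-exp v / (1 + exp v) ^ 2) v := by
  have h := ((hasDerivAt_exp v).const_add 1).inv (by positivity)
  refine h.congr_of_eventuallyEq (.of_forall fun w => ?_)
  simp [expRecip]

theorem convexOn_expRecip : ConvexOn ℝ (Set.Ici 0) expRecip := by
  refine MonotoneOn.convexOn_of_deriv (convex_Ici 0)
    (fun v _ => (hasDerivAt_expRecip v).continuousAt.continuousWithinAt)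
    (fun v _ => (hasDerivAt_expRecip v).differentiableAt.differentiableWithinAt) ?_
  rw [interior_Ici]
  intro v hv w hw hvw
  rw [(hasDerivAt_expRecip v).deriv, (hasDerivAt_expRecip w).deriv, div_le_div_iff₀
    (by positivity) (by positivity)]
  have h1 : 1 ≤ exp v := one_le_exp (le_of_lt hv)
  have h2 : exp v ≤ exp w := exp_le_exp.2 hvw
  nlinarith [mul_nonneg (sub_nonneg.2 h2) (sub_nonneg.2 (one_le_mul_of_one_le_of_one_le h1
    (h1.trans h2)))]

theorem expRecip_le_convexComb {a b θ : ℝ} (ha : 0 ≤ a) (hb : 0 ≤ b) (h0 : 0 ≤ θ) (h1 : θ ≤ 1) :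
    expRecip ((1 - θ) * a + θ * b) ≤ (1 - θ) * expRecip a + θ * expRecip b := by
  simpa using convexOn_expRecip.2 ha hb (sub_nonneg.2 h1) h0 (by ring)

/-- The sum of `expRecip` over an arithmetic progression. -/
noncomputable def progressionSum (N : ℕ) (τ : ℝ) (x : ℕ) : ℝ :=
  ∑' j : ℕ, expRecip (τ * (x + N * j))

theorem summable_progression {N : ℕ} (hN : 0 < N) {τ : ℝ} (hτ : 0 < τ) (x : ℕ) :
    Summable fun j : ℕ => expRecip (τ * (x + N * j)) := by
  refine Summable.of_nonneg_of_le (fun j => expRecip_nonneg _) (fun j => ?_)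
    (summable_geometric_of_lt_one (exp_pos (-(τ * N))).le (by
      have : 0 < τ * N := by positivity
      simpa using this))
  refine (expRecip_le _).trans ?_
  rw [← exp_nat_mul, exp_le_exp]
  have : 0 ≤ τ * x := by positivity
  nlinarith

theorem progressionSum_add {N : ℕ} (hN : 0 < N) {τ : ℝ} (hτ : 0 < τ) (x : ℕ) :
    progressionSum N τ (x + N) = progressionSum N τ x - expRecip (τ * x) := by
  rw [progressionSum, progressionSum, (summable_progression hN hτ x).tsum_eq_zero_add]
  simp only [Nat.cast_zero, mul_zero, add_zero, add_sub_cancel_left]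
  refine tsum_congr fun j => ?_
  push_cast
  ring_nf

theorem progressionSum_le_convexComb {N : ℕ} (hN : 0 < N) {τ : ℝ} (hτ : 0 < τ) {x a b : ℕ}
    {θ : ℝ} (h0 : 0 ≤ θ) (h1 : θ ≤ 1) (hx : (x : ℝ) = (1 - θ) * a + θ * b) :
    progressionSum N τ x ≤ (1 - θ) * progressionSum N τ a + θ * progressionSum N τ b := by
  have ha := (summable_progression hN hτ a).mul_left (1 - θ)
  have hb := (summable_progression hN hτ b).mul_left θ
  rw [progressionSum, progressionSum, progressionSum, ← tsum_mul_left, ← tsum_mul_left,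
    ← ha.tsum_add hb]
  refine (summable_progression hN hτ x).tsum_le_tsum (fun j => ?_) (ha.add hb)
  have e : τ * (x + N * j) = (1 - θ) * (τ * (a + N * j)) + θ * (τ * (b + N * j)) := by
    rw [hx]; ring
  rw [e]
  exact expRecip_le_convexComb (by positivity) (by positivity) h0 h1

theorem tendsto_progressionSum_sub {N : ℕ} (hN : 0 < N) {x : ℕ} (hx : x ≤ N) :
    Tendsto (fun τ : ℝ => progressionSum N τ 0 - progressionSum N τ x) (𝓝[>] 0)
      (𝓝 (x / (2 * N))) := by
  have hN' : (0 : ℝ) < N := by exact_mod_cast hN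
  have hx' : (x : ℝ) ≤ N := by exact_mod_cast hx
  set θ : ℝ := x / N with hθ
  have h0 : 0 ≤ θ := by positivity
  have h1 : θ ≤ 1 := (div_le_one hN').2 hx'
  have hθN : θ * N = x := by rw [hθ]; field_simp
  have hlim : (x : ℝ) / (2 * N) = θ / 2 := by rw [hθ]; field_simp
  have hψ0 : expRecip 0 = 1 / 2 := by norm_num [expRecip]
  rw [hlim]
  have hup : Tendsto (fun τ : ℝ => 1 / 2 - (1 - θ) * expRecip (τ * x)) (𝓝[>] 0) (𝓝 (θ / 2)) := by
    have hc : Continuous fun τ : ℝ => 1 / 2 - (1 - θ) * expRecip (τ * x) := by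
      have : Continuous expRecip := continuous_iff_continuousAt.2 fun v =>
        (hasDerivAt_expRecip v).continuousAt
      fun_prop
    have h := (hc.tendsto 0).mono_left (nhdsWithin_le_nhds (s := Set.Ioi 0))
    have e : 1 / 2 - (1 - θ) * expRecip (0 * x) = θ / 2 := by rw [zero_mul, hψ0]; ring
    rwa [e] at h
  refine tendsto_of_tendsto_of_tendsto_of_le_of_le' tendsto_const_nhds hup ?_ ?_
  · filter_upwards [self_mem_nhdsWithin] with τ hτ
    have h := progressionSum_le_convexComb hN hτ (x := x) (a := 0) (b := 0 + N) h0 h1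
      (by push_cast; linear_combination -hθN)
    rw [progressionSum_add hN hτ, Nat.cast_zero, mul_zero, hψ0] at h
    linarith
  · filter_upwards [self_mem_nhdsWithin] with τ hτ
    have h := progressionSum_le_convexComb hN hτ (x := 0 + N) (a := x) (b := x + N)
      (sub_nonneg.2 h1) (by linarith : 1 - θ ≤ 1) (by push_cast; linear_combination hθN)
    rw [progressionSum_add hN hτ, progressionSum_add hN hτ, Nat.cast_zero, mul_zero, hψ0] at h
    linarith

theorem tendsto_tsum_mul_expRecip {N : ℕ} [NeZero N] {f : ℕ → ℝ} (hf : ∀ n, |f n| ≤ 1)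
    (hper : ∀ x j, f (x + N * j) = f x) (hsum : ∑ a : ZMod N, f a.val = 0) :
    Tendsto (fun τ : ℝ => ∑' d : ℕ, f d * expRecip (τ * d)) (𝓝[>] 0)
      (𝓝 (-∑ a : ZMod N, f a.val * (a.val / (2 * N)))) := by
  have hN : 0 < N := NeZero.pos N
  have h1 : Tendsto (fun τ : ℝ => -∑ a : ZMod N, f a.val *
      (progressionSum N τ 0 - progressionSum N τ a.val)) (𝓝[>] 0)
      (𝓝 (-∑ a : ZMod N, f a.val * (a.val / (2 * N)))) :=
    (tendsto_finsetSum _ fun a _ =>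
      (tendsto_progressionSum_sub hN (ZMod.val_lt a).le).const_mul _).neg
  refine h1.congr' ?_
  filter_upwards [self_mem_nhdsWithin] with τ hτ
  have hs : Summable fun d : ℕ => f d * expRecip (τ * d) := by
    have h := summable_progression one_pos hτ 0
    simp only [Nat.cast_zero, Nat.cast_one, zero_add, one_mul] at h
    refine Summable.of_norm_bounded h fun d => ?_
    rw [norm_mul, Real.norm_eq_abs, Real.norm_eq_abs, abs_of_nonneg (expRecip_nonneg _)]
    exact mul_le_of_le_one_left (expRecip_nonneg _) (hf d)
  rw [Nat.sumByResidueClasses hs N]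
  simp only [mul_sub, Finset.sum_sub_distrib, ← Finset.sum_mul, hsum, zero_mul, zero_sub, neg_neg]
  refine Finset.sum_congr rfl fun a _ => ?_
  simp only [hper, progressionSum, ← tsum_mul_left]
  push_cast
  rfl

end Lambert

section ClassNumber

open Real Filter Topology

theorem abs_legendreSym_le_one (ℓ : ℕ) [Fact ℓ.Prime] (n : ℤ) : |(legendreSym ℓ n : ℝ)| ≤ 1 := by
  by_cases h : (n : ZMod ℓ) = 0
  · simp [(legendreSym.eq_zero_iff ℓ n).2 h]
  · rcases legendreSym.eq_one_or_neg_one ℓ h with h | h <;> simp [h]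

theorem ZMod.sum_val_eq_sum_range {M : Type*} [AddCommMonoid M] (N : ℕ) [NeZero N] (f : ℕ → M) :
    ∑ a : ZMod N, f a.val = ∑ x ∈ Finset.range N, f x :=
  Finset.sum_nbij' (fun a => a.val) (fun n => (n : ZMod N))
    (fun a _ => Finset.mem_range.2 a.val_lt) (fun _ _ => Finset.mem_univ _)
    (fun a _ => ZMod.natCast_zmod_val a)
    (fun _ hn => ZMod.val_cast_of_lt (Finset.mem_range.1 hn)) (fun _ _ => rfl)

theorem tendsto_two_mul_nhdsGT_zero : Tendsto (fun u : ℝ => 2 * u) (𝓝[>] 0) (𝓝[>] 0) := by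
  refine tendsto_nhdsWithin_iff.2 ⟨?_, ?_⟩
  · have : Continuous fun u : ℝ => 2 * u := by fun_prop
    simpa using (this.tendsto 0).mono_left (nhdsWithin_le_nhds (s := Set.Ioi 0))
  · filter_upwards [self_mem_nhdsWithin] with u hu
    exact mul_pos two_pos (Set.mem_Ioi.1 hu)

theorem tendsto_tsum_sub_two_mul {ℓ : ℕ} :
    Tendsto (fun u : ℝ =>
      ∑' q : oddSymmTriples ℓ, (∑' v : ℤ × ℤ, exp (-u * sectorForm q v) - 1) -
        2 * ∑' q : oddSymmTriples ℓ, (∑' v : ℤ × ℤ, exp (-(2 * u) * sectorForm q v) - 1))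
      (𝓝[>] 0) (𝓝 (oddSymmTriples ℓ).ncard) := by
  have := Fintype.ofFinite (oddSymmTriples ℓ)
  have hq (q : oddSymmTriples ℓ) := tendsto_tsum_exp_neg_sectorForm_sub q.2.1 q.2.2.2.1
    q.2.2.2.2.2.1 q.2.2.2.2.2.2.2
  have h := tendsto_finsetSum Finset.univ fun (q : oddSymmTriples ℓ) _ =>
    ((hq q).sub (((hq q).comp tendsto_two_mul_nhdsGT_zero).const_mul 2)).add_const 1
  have hcard : ∑ q : oddSymmTriples ℓ, ((0 : ℝ) - 2 * 0 + 1) = (oddSymmTriples ℓ).ncard := by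
    rw [← Nat.card_coe_set_eq, Nat.card_eq_fintype_card]
    simp
  rw [hcard] at h
  refine h.congr fun u => ?_
  rw [tsum_fintype, tsum_fintype, Finset.mul_sum, ← Finset.sum_sub_distrib]
  refine Finset.sum_congr rfl fun q _ => ?_
  simp only [Function.comp_apply]
  have : π / (√ℓ * u) = 2 * (π / (√ℓ * (2 * u))) := by
    rw [mul_left_comm, ← div_div π 2, mul_div_assoc', mul_div_cancel₀ _ two_ne_zero]
  rw [this]
  ring

theorem tsum_sub_one_eq_tsum_legendreSym {ℓ : ℕ} [Fact ℓ.Prime] (h8 : ℓ % 8 = 3) {u : ℝ}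
    (hu : 0 < u) :
    ∑' q : oddSymmTriples ℓ, (∑' v : ℤ × ℤ, exp (-u * sectorForm q v) - 1) =
      6 * ∑' m : ℕ, (∑ d ∈ m.divisors, (legendreSym ℓ d : ℝ)) * exp (-(2 * u) * m) := by
  rw [tsum_sub_one_eq_tsum_ncard_sectorReps ℓ hu]
  congr 1
  refine tsum_congr fun m => ?_
  congr 1
  rcases Nat.eq_zero_or_pos m with rfl | hm
  · have : sectorReps ℓ (0 : ℕ) = ∅ := by
      ext ⟨r, s, t, x, y⟩
      simp only [Set.mem_empty_iff_false, iff_false]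
      rintro ⟨h1, -, h2, -, h3, -, -, hx, hy, e⟩
      dsimp only at *
      have : 0 < r * (x + y) ^ 2 + s * x ^ 2 + t * y ^ 2 := by positivity
      rw [e] at this
      simp at this
    rw [this]
    simp
  · exact_mod_cast ncard_sectorReps_eq_sum_legendreSym h8 hm

theorem ncard_oddSymmTriples_eq_sum {ℓ : ℕ} [Fact ℓ.Prime] (h8 : ℓ % 8 = 3) :
    ((oddSymmTriples ℓ).ncard : ℤ) * ℓ =
      -3 * ∑ x ∈ Finset.range ℓ, (x : ℤ) * legendreSym ℓ x := by
  have hℓ : (0 : ℝ) < ℓ := by exact_mod_cast (Fact.out : ℓ.Prime).pos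
  set f : ℕ → ℝ := fun n => legendreSym ℓ n with hf
  have hsum : ∑ a : ZMod ℓ, f a.val = 0 := by
    have h := quadraticChar_sum_zero (F := ZMod ℓ) (by rw [ZMod.ringChar_zmod_n]; omega)
    have : ∑ a : ZMod ℓ, legendreSym ℓ (a.val : ℕ) = 0 := by
      rw [← h]
      exact Finset.sum_congr rfl fun a _ => by simp [legendreSym]
    simp only [hf]
    exact_mod_cast this
  have h1 := ((tendsto_tsum_mul_expRecip (N := ℓ) (f := f)
    (fun n => abs_legendreSym_le_one ℓ n) (fun x j => by simp [hf, legendreSym])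
    hsum).comp tendsto_two_mul_nhdsGT_zero).const_mul 6
  have h2 := tendsto_nhds_unique (tendsto_tsum_sub_two_mul (ℓ := ℓ)) (h1.congr' ?_)
  · rw [ZMod.sum_val_eq_sum_range ℓ fun n => f n * (n / (2 * ℓ))] at h2
    have h3 : ∑ x ∈ Finset.range ℓ, f x * (x / (2 * ℓ)) =
        ((∑ x ∈ Finset.range ℓ, (x : ℤ) * legendreSym ℓ x : ℤ) : ℝ) / (2 * ℓ) := by
      push_cast
      rw [Finset.sum_div]
      exact Finset.sum_congr rfl fun x _ => by simp only [hf]; ring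
    rw [h3] at h2
    have h4 : ((oddSymmTriples ℓ).ncard : ℝ) * ℓ =
        -3 * ((∑ x ∈ Finset.range ℓ, (x : ℤ) * legendreSym ℓ x : ℤ) : ℝ) := by
      rw [h2]; field_simp; ring
    exact_mod_cast h4
  · filter_upwards [self_mem_nhdsWithin] with u hu
    have hu' : (0 : ℝ) < 2 * u := mul_pos two_pos hu
    rw [tsum_sub_one_eq_tsum_legendreSym h8 hu, tsum_sub_one_eq_tsum_legendreSym h8 hu',
      Function.comp_apply,
      ← tsum_lambert_sub (f := f) (fun n => abs_legendreSym_le_one ℓ n) (by simp [hf]) hu']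
    ring

theorem sum_range_two_mul_add_one_reflect {M : Type*} [AddCommMonoid M] (f : ℕ → M) (k : ℕ) :
    ∑ x ∈ Finset.range (2 * k + 1), f x =
      f 0 + ∑ i ∈ Finset.range k, (f (i + 1) + f (2 * k + 1 - (i + 1))) := by
  have h1 : ∑ i ∈ Finset.range k, f (2 * k + 1 - (i + 1)) =
      ∑ i ∈ Finset.range k, f (k + i + 1) := by
    rw [← Finset.sum_range_reflect]
    refine Finset.sum_congr rfl fun i hi => ?_
    have := Finset.mem_range.1 hi
    congr 1
    omega
  rw [Finset.sum_add_distrib, h1, Finset.sum_range_succ', two_mul, Finset.sum_range_add, add_comm]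

theorem sum_range_two_mul_add_one_parity {M : Type*} [AddCommMonoid M] (f : ℕ → M) (k : ℕ) :
    ∑ x ∈ Finset.range (2 * k + 1), f x =
      f 0 + ∑ i ∈ Finset.range k, (f (2 * (i + 1)) + f (2 * k + 1 - 2 * (i + 1))) := by
  have h1 : ∑ i ∈ Finset.range k, f (2 * k + 1 - 2 * (i + 1)) =
      ∑ i ∈ Finset.range k, f (2 * i + 1) := by
    rw [← Finset.sum_range_reflect]
    refine Finset.sum_congr rfl fun i hi => ?_
    have := Finset.mem_range.1 hi
    congr 1
    omega
  rw [Finset.sum_add_distrib, h1, ← Finset.sum_add_distrib]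
  clear h1
  induction k with
  | zero => simp
  | succ k ih =>
    rw [Finset.sum_range_succ _ k, ← add_assoc, ← ih, show 2 * (k + 1) + 1 = 2 * k + 1 + 1 + 1 by
      ring, Finset.sum_range_succ, Finset.sum_range_succ, add_assoc, add_comm (f (2 * k + 1))]
    rfl

theorem three_mul_sum_legendreSym {ℓ k : ℕ} [Fact ℓ.Prime] (h8 : ℓ % 8 = 3)
    (hk : ℓ = 2 * k + 1) :
    3 * ∑ x ∈ Finset.range ℓ, (x : ℤ) * legendreSym ℓ x =
      -(ℓ * ∑ i ∈ Finset.range k, legendreSym ℓ (i + 1 : ℕ)) := by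
  have hneg (y : ℕ) (hy : y ≤ ℓ) : legendreSym ℓ (ℓ - y : ℕ) = -legendreSym ℓ y := by
    have e : ((ℓ - y : ℕ) : ℤ) ≡ -1 * y [ZMOD ℓ] := by
      rw [Nat.cast_sub hy, Int.modEq_iff_dvd]
      exact ⟨-1, by ring⟩
    rw [legendreSym.mod, e, ← legendreSym.mod, legendreSym.mul, legendreSym.at_neg_one (by omega),
      ZMod.χ₄_nat_three_mod_four (by omega)]
    ring
  have htwo (y : ℕ) : legendreSym ℓ (2 * y : ℕ) = -legendreSym ℓ y := by
    push_cast
    rw [legendreSym.mul, legendreSym.at_two (by omega), ZMod.χ₈_nat_eq_if_mod_eight, h8]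
    norm_num
    omega
  set f : ℕ → ℤ := fun x => (x : ℤ) * legendreSym ℓ x with hf
  have h1 : ∑ x ∈ Finset.range ℓ, f x =
      ∑ i ∈ Finset.range k, (2 * ((i + 1 : ℕ) : ℤ) - ℓ) * legendreSym ℓ (i + 1 : ℕ) := by
    have h := sum_range_two_mul_add_one_reflect f k
    rw [← hk] at h
    rw [h]
    simp only [hf, Nat.cast_zero, zero_mul, zero_add]
    refine Finset.sum_congr rfl fun i hi => ?_
    have hi' := Finset.mem_range.1 hi
    rw [hneg _ (by omega), Nat.cast_sub (by omega)]
    ring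
  have h2 : ∑ x ∈ Finset.range ℓ, f x =
      ∑ i ∈ Finset.range k, (ℓ - 4 * ((i + 1 : ℕ) : ℤ)) * legendreSym ℓ (i + 1 : ℕ) := by
    have h := sum_range_two_mul_add_one_parity f k
    rw [← hk] at h
    rw [h]
    simp only [hf, Nat.cast_zero, zero_mul, zero_add]
    refine Finset.sum_congr rfl fun i hi => ?_
    have hi' := Finset.mem_range.1 hi
    rw [hneg _ (by omega), htwo, Nat.cast_sub (by omega)]
    push_cast
    ring
  have h3 : 3 * ∑ x ∈ Finset.range ℓ, f x = 2 * ∑ x ∈ Finset.range ℓ, f x +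
    ∑ x ∈ Finset.range ℓ, f x := by ring
  rw [h3]
  nth_rewrite 1 [h1]
  rw [h2, Finset.mul_sum, Finset.mul_sum, ← Finset.sum_add_distrib, ← Finset.sum_neg_distrib]
  exact Finset.sum_congr rfl fun i _ => by ring

theorem ncard_oddSymmTriples {ℓ k : ℕ} [Fact ℓ.Prime] (h8 : ℓ % 8 = 3) (hk : ℓ = 2 * k + 1) :
    ((oddSymmTriples ℓ).ncard : ℤ) = ∑ i ∈ Finset.range k, legendreSym ℓ (i + 1 : ℕ) := by
  have h1 := ncard_oddSymmTriples_eq_sum h8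
  have h2 := three_mul_sum_legendreSym h8 hk
  have hℓ : (ℓ : ℤ) ≠ 0 := by exact_mod_cast (Fact.out : ℓ.Prime).ne_zero
  apply mul_right_cancel₀ hℓ
  linear_combination h1 - h2

theorem sum_legendreSym_eq_card_sub_card {ℓ k : ℕ} [Fact ℓ.Prime] (hk : k < ℓ) :
    ∑ i ∈ Finset.range k, legendreSym ℓ (i + 1 : ℕ) =
      (Nat.card {x : ℕ // 1 ≤ x ∧ x ≤ k ∧ IsSquare (x : ZMod ℓ)} : ℤ) -
        (Nat.card {x : ℕ // 1 ≤ x ∧ x ≤ k ∧ ¬ IsSquare (x : ZMod ℓ)} : ℤ) := by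
  classical
  rw [Nat.subtype_card ((Finset.Icc 1 k).filter fun x : ℕ => IsSquare (x : ZMod ℓ))
      (by simp [and_assoc]),
    Nat.subtype_card ((Finset.Icc 1 k).filter fun x : ℕ => ¬ IsSquare (x : ZMod ℓ))
      (by simp [and_assoc]), Finset.card_filter, Finset.card_filter]
  push_cast
  rw [← Finset.sum_sub_distrib]
  refine Finset.sum_nbij' (fun i => i + 1) (fun x => x - 1) ?_ ?_ ?_ ?_ ?_
  · intro i hi; simp at hi ⊢; omega
  · intro i hi; simp at hi ⊢; omega
  · intro i hi; simp
  · intro i hi; simp at hi; omega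
  · intro i hi
    have hi' := Finset.mem_range.1 hi
    have h0 : ((i + 1 : ℕ) : ZMod ℓ) ≠ 0 := by
      rw [Ne, ZMod.natCast_eq_zero_iff]
      exact fun h => absurd (Nat.le_of_dvd (by omega) h) (by omega)
    by_cases hsq : IsSquare ((i + 1 : ℕ) : ZMod ℓ)
    · rw [if_pos hsq, if_neg (not_not.2 hsq), sub_zero]
      exact (legendreSym.eq_one_iff' ℓ h0).2 hsq
    · rw [if_neg hsq, if_pos hsq, zero_sub]
      exact (legendreSym.eq_neg_one_iff' ℓ).2 hsq

end ClassNumber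

theorem q3_eq_ncard_oddSquareTriples (n : ℕ) : q3 n = (oddSquareTriples n).ncard := by
  rw [q3, ← Nat.card_coe_set_eq]
  simp only [Int.odd_iff]
  rfl

/-- For a prime `ℓ ≡ 3 (mod 8)`, `q₃(ℓ) = R - N`, where `R` (resp. `N`) is the number of
quadratic residues (resp. non-residues) modulo `ℓ` in the interval `[1, (ℓ-1)/2]`. -/
theorem q3_eq_R_sub_N (ℓ : ℕ) (hℓ : ℓ.Prime) (h8 : ℓ % 8 = 3) :
    (q3 ℓ : ℤ) =
      (Nat.card {x : ℕ // 1 ≤ x ∧ x ≤ (ℓ - 1) / 2 ∧ IsSquare (x : ZMod ℓ)} : ℤ) -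
      (Nat.card {x : ℕ // 1 ≤ x ∧ x ≤ (ℓ - 1) / 2 ∧ ¬IsSquare (x : ZMod ℓ)} : ℤ) := by
  have : Fact ℓ.Prime := ⟨hℓ⟩
  have h1 := ncard_oddSquareTriples ((ℓ + 1) / 4) (by omega)
  have h2 : (4 * ((ℓ + 1) / 4 : ℕ) - 1 : ℤ) = ℓ := by omega
  rw [h2] at h1
  rw [q3_eq_ncard_oddSquareTriples, h1, ncard_oddSymmTriples h8 (k := (ℓ - 1) / 2) (by omega),
    sum_legendreSym_eq_card_sub_card (by omega)]
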